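/- Let u ∈ k^* and let α ∈ Aff_3(k) \ B have type (γ1,γ2,γ3). If γ1 = γ2 = γ3 = 3, then there exists a lift of α which satisfies condition (C). -/

import Mathlib

open MvPolynomial

noncomputable section

namespace YasudaPaper

variable {k : Type*} [Field k]

/-- `f := x1*x3 - x2^2` (variables: `X 0 = x1, X 1 = x2, X 2 = x3`). -/
def fP : MvPolynomial (Fin 3) k := X 0 * X 2 - X 1 ^ 2

/-- `r := x2*f + x1^2`. -/
def rP : MvPolynomial (Fin 3) k := X 1 * fP + X 0 ^ 2

/-- `g := x3*f^2 + 2*x1*x2*f + x1^3`. -/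
def gP : MvPolynomial (Fin 3) k := X 2 * fP ^ 2 + 2 * X 0 * X 1 * fP + X 0 ^ 3

/-- The Jacobian derivation `Δ = Δ_{(f,g)}`, `h ↦ det ∂(f,g,h)/∂(x1,x2,x3)`. -/
def Del (h : MvPolynomial (Fin 3) k) : MvPolynomial (Fin 3) k :=
  Matrix.det !![pderiv 0 fP, pderiv 1 fP, pderiv 2 fP;
                pderiv 0 gP, pderiv 1 gP, pderiv 2 gP;
                pderiv 0 h,  pderiv 1 h,  pderiv 2 h]

/-- `φ = exp D`: for every `h` and every `N` with `D^[N] h = 0`,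
    `φ h = ∑_{i<N} D^i(h)/i!`.  (For a locally nilpotent `D` this characterizes
    the exponential automorphism.) -/
def IsExpOf {σ : Type*} (D : MvPolynomial σ k → MvPolynomial σ k)
    (φ : MvPolynomial σ k ≃ₐ[k] MvPolynomial σ k) : Prop :=
  ∀ (h : MvPolynomial σ k) (N : ℕ), D^[N] h = 0 →
    φ h = ∑ i ∈ Finset.range N, (Nat.factorial i : k)⁻¹ • D^[i] h

/-- `α` is an affine automorphism: `α(x_i) = ∑_j a_{j,i} x_j + b_i` with `A ∈ GL₃(k)`. -/
def IsAffine (α : MvPolynomial (Fin 3) k ≃ₐ[k] MvPolynomial (Fin 3) k) : Prop :=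
  ∃ (A : Matrix (Fin 3) (Fin 3) k) (b : Fin 3 → k), IsUnit A.det ∧
    ∀ i : Fin 3, α (X i) = (∑ j : Fin 3, C (A j i) * X j) + C (b i)

/-- `Aff_3(k)` as a set of automorphisms. -/
def AffSet : Set (MvPolynomial (Fin 3) k ≃ₐ[k] MvPolynomial (Fin 3) k) := {α | IsAffine α}

/-- `α` is a triangular automorphism: `α(x_i) = a_i x_i + f_i(x_1,…,x_{i-1})`, `a_i ≠ 0`. -/
def IsTriangular (α : MvPolynomial (Fin 3) k ≃ₐ[k] MvPolynomial (Fin 3) k) : Prop :=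
  ∃ (a : Fin 3 → k) (p : Fin 3 → MvPolynomial (Fin 3) k),
    (∀ i, a i ≠ 0) ∧ (∀ i, p i ∈ MvPolynomial.supported k {j | j < i}) ∧
    (∀ i, α (X i) = C (a i) * X i + p i)

/-- `BA_3(k)` as a set of automorphisms. -/
def TriSet : Set (MvPolynomial (Fin 3) k ≃ₐ[k] MvPolynomial (Fin 3) k) := {α | IsTriangular α}

/-- The tame subgroup `TA_3(k) = ⟨Aff_3(k), BA_3(k)⟩`. -/
def TA : Subgroup (MvPolynomial (Fin 3) k ≃ₐ[k] MvPolynomial (Fin 3) k) :=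
  Subgroup.closure (AffSet ∪ TriSet)

/-- `β = β_u = (u^3 x1, u^2 x2, u x3)`. -/
def IsBeta (u : k) (β : MvPolynomial (Fin 3) k ≃ₐ[k] MvPolynomial (Fin 3) k) : Prop :=
  β (X 0) = C (u ^ 3) * X 0 ∧ β (X 1) = C (u ^ 2) * X 1 ∧ β (X 2) = C u * X 2

/-- `B = {β_u | u ∈ k^*}`. -/
def BSet : Set (MvPolynomial (Fin 3) k ≃ₐ[k] MvPolynomial (Fin 3) k) :=
  {β | ∃ u : k, u ≠ 0 ∧ IsBeta u β}

/-! Six-variable ring `k[x1,x2,x3,t_r,t_f,t_g]`: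
variables `X 0 = x1, X 1 = x2, X 2 = x3, X 3 = t_r, X 4 = t_f, X 5 = t_g`. -/

/-- The inclusion of variable index sets. -/
def ι36 : Fin 3 → Fin 6 := Fin.castLE (by norm_num)

/-- The embedding `k[x1,x2,x3] → k[x1,x2,x3,t_r,t_f,t_g]`. -/
def embP : MvPolynomial (Fin 3) k →ₐ[k] MvPolynomial (Fin 6) k := rename ι36

/-- The substitution map `π : t_r ↦ r, t_f ↦ f, t_g ↦ g` (fixing `x1,x2,x3`). -/
def piMap : MvPolynomial (Fin 6) k →ₐ[k] MvPolynomial (Fin 3) k :=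
  aeval ![X 0, X 1, X 2, rP, fP, gP]

/-- The triangular derivation
`Δ' = -2 t_r t_f ∂/∂x1 + (4 x1 t_r - t_g) ∂/∂x2 + (6 x2 t_r + 2 t_f²) ∂/∂x3 - t_f t_g ∂/∂t_r`. -/
def Del' (p : MvPolynomial (Fin 6) k) : MvPolynomial (Fin 6) k :=
  (-(2 * X 3 * X 4)) * pderiv 0 p + (4 * X 0 * X 3 - X 5) * pderiv 1 p +
  (6 * X 1 * X 3 + 2 * X 4 ^ 2) * pderiv 2 p + (-(X 4 * X 5)) * pderiv 3 p

/-- The weight `w1 = (1,2,3,1,0,1)`. -/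
def w1 : Fin 6 → ℕ := ![1, 2, 3, 1, 0, 1]

/-- The weight `w2 = (0,0,0,0,1,0)`. -/
def w2 : Fin 6 → ℕ := ![0, 0, 0, 0, 1, 0]

/-- The sixth cyclic lexicographic order on exponent vectors: first compare the
exponent of `t_g`, then lexicographically the exponents of `x1,x2,x3,t_r,t_f`. -/
def cyclicLt (a b : Fin 6 →₀ ℕ) : Prop :=
  a 5 < b 5 ∨ (a 5 = b 5 ∧ ∃ m : Fin 5,
    (∀ l : Fin 5, l < m → a l.castSucc = b l.castSucc) ∧ a m.castSucc < b m.castSucc)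

/-- The leading monomial of `p` (for the sixth cyclic lexicographic order) is `m`. -/
def LeadMonIs (p : MvPolynomial (Fin 6) k) (m : Fin 6 →₀ ℕ) : Prop :=
  m ∈ p.support ∧ ∀ m' ∈ p.support, m' ≠ m → cyclicLt m' m

/-- The exponent vector of the monomial `t_f^δ t_g^γ`. -/
def tfMon (γ δ : ℕ) : Fin 6 →₀ ℕ := Finsupp.single 4 δ + Finsupp.single 5 γ

/-- The set `P_{γ,δ}`. -/
def Pset (γ δ : ℕ) : Set (MvPolynomial (Fin 6) k) :=
  {p | p ≠ 0 ∧ weightedTotalDegree w1 p ≤ γ ∧ weightedTotalDegree w2 p ≤ δ ∧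
    LeadMonIs p (tfMon γ δ)}

/-- `α'` is a lift of `α`. -/
def IsLift (α : MvPolynomial (Fin 3) k ≃ₐ[k] MvPolynomial (Fin 3) k)
    (α' : MvPolynomial (Fin 6) k →ₐ[k] MvPolynomial (Fin 6) k) : Prop :=
  (∀ i : Fin 3, α' (X (ι36 i)) = embP (α (X i))) ∧
  (∀ p, piMap (α' p) = α (piMap p))

/-- `t = γ_j = max {i | a_{i,j} ≠ 0}` (with rows indexed `1,2,3`). -/
def TypeIs (A : Matrix (Fin 3) (Fin 3) k) (j : Fin 3) (t : ℕ) : Prop :=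
  ∃ i : Fin 3, t = (i : ℕ) + 1 ∧ A i j ≠ 0 ∧ ∀ i' : Fin 3, i < i' → A i' j = 0

/-- Condition (C) for a lift `α'` of an affine automorphism of type `(γ1,γ2,γ3)`,
relative to `φ' = exp(uΔ')`. -/
def CondC (γ1 γ2 γ3 : ℕ) (φ' : MvPolynomial (Fin 6) k ≃ₐ[k] MvPolynomial (Fin 6) k)
    (α' : MvPolynomial (Fin 6) k →ₐ[k] MvPolynomial (Fin 6) k) : Prop :=
  ∃ m4 m5 m6 n4 n5 n6 : ℕ,
    1 ≤ n4 ∧ 1 ≤ n5 ∧ 1 ≤ n6 ∧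
    φ' (α' (X 3)) ∈ Pset m4 n4 ∧
    φ' (α' (X 4)) ∈ Pset m5 n5 ∧
    φ' (α' (X 5)) ∈ Pset m6 n6 ∧
    γ1 ≤ m6 ∧ γ2 ≤ 2 * m6 ∧ γ3 ≤ 3 * m6 ∧ m4 ≤ m6 ∧
    γ1 + 1 ≤ n6 - 1 ∧ γ2 + 1 ≤ 2 * (n6 - 1) ∧ γ3 + 1 ≤ 3 * (n6 - 1) ∧ n4 ≤ n6 - 1

/-- The image of `x_j` under the affine map given by `(A, d)`, inside the six-variable ring. -/
def affImg (A : Matrix (Fin 3) (Fin 3) k) (d : Fin 3 → k) (j : Fin 3) :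
    MvPolynomial (Fin 6) k :=
  (∑ i : Fin 3, C (A i j) * X (ι36 i)) + C (d j)

/-- The image of `t_f` under the lift `α̂`:
`α̂(t_f) = α(f) + (a_{1,1}a_{3,3} - 2a_{1,2}a_{3,2} + a_{1,3}a_{3,1})(t_f - f)`. -/
def hatTf (A : Matrix (Fin 3) (Fin 3) k) (d : Fin 3 → k) : MvPolynomial (Fin 6) k :=
  (affImg A d 0 * affImg A d 2 - affImg A d 1 ^ 2) +
    C (A 0 0 * A 2 2 - 2 * (A 0 1 * A 2 1) + A 0 2 * A 2 0) *
      (X 4 - (X 0 * X 2 - X 1 ^ 2))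

/-- The lift `α̂` of the affine automorphism given by `(A, d)`:
`α̂(x_i) = α(x_i)`, `α̂(t_f)` as in `hatTf`, `α̂(t_r) = α̂(x2 t_f + x1²)`,
`α̂(t_g) = α̂(x3 t_f² + 2 x1 x2 t_f + x1³)`. -/
def hatLift (A : Matrix (Fin 3) (Fin 3) k) (d : Fin 3 → k) :
    MvPolynomial (Fin 6) k →ₐ[k] MvPolynomial (Fin 6) k :=
  aeval ![affImg A d 0, affImg A d 1, affImg A d 2,
    affImg A d 1 * hatTf A d + affImg A d 0 ^ 2,
    hatTf A d,
    affImg A d 2 * hatTf A d ^ 2 + 2 * affImg A d 0 * affImg A d 1 * hatTf A d +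
      affImg A d 0 ^ 3]

/-! ### Polynomials with bounded weights and a prescribed top coefficient -/

/-- `p` has `w1`-degree at most `γ`, `w2`-degree at most `δ`, and `c` is the coefficient of
`t_f^δ t_g^γ` in `p`. -/
def HasTop (γ δ : ℕ) (c : k) (p : MvPolynomial (Fin 6) k) : Prop :=
  (∀ m ∈ p.support, Finsupp.weight w1 m ≤ γ ∧ Finsupp.weight w2 m ≤ δ) ∧
    coeff (tfMon γ δ) p = c

lemma weight_w1_apply (m : Fin 6 →₀ ℕ) :
    Finsupp.weight w1 m = m 0 + 2 * m 1 + 3 * m 2 + m 3 + m 5 := by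
  rw [Finsupp.weight_apply, Finsupp.sum_fintype _ _ (by simp)]
  simp [Fin.sum_univ_succ, w1]
  ring

lemma weight_w2_apply (m : Fin 6 →₀ ℕ) : Finsupp.weight w2 m = m 4 := by
  rw [Finsupp.weight_apply, Finsupp.sum_fintype _ _ (by simp)]
  simp [Fin.sum_univ_succ, w2]

lemma tfMon_add (γ δ γ' δ' : ℕ) : tfMon (γ + γ') (δ + δ') = tfMon γ δ + tfMon γ' δ' := by
  simp only [tfMon, Finsupp.single_add]
  abel

lemma tfMon_apply (γ δ : ℕ) :
    tfMon γ δ 0 = 0 ∧ tfMon γ δ 1 = 0 ∧ tfMon γ δ 2 = 0 ∧ tfMon γ δ 3 = 0 ∧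
      tfMon γ δ 4 = δ ∧ tfMon γ δ 5 = γ := by
  simp [tfMon]

lemma eq_tfMon {m : Fin 6 →₀ ℕ} {γ δ : ℕ} (h0 : m 0 = 0) (h1 : m 1 = 0) (h2 : m 2 = 0)
    (h3 : m 3 = 0) (h4 : m 4 = δ) (h5 : m 5 = γ) : m = tfMon γ δ := by
  obtain ⟨e0, e1, e2, e3, e4, e5⟩ := tfMon_apply γ δ
  ext i
  fin_cases i <;> simp_all

namespace HasTop

variable {γ δ γ' δ' : ℕ} {c c' : k} {p q : MvPolynomial (Fin 6) k}

lemma mem_Pset (h : HasTop γ δ c p) (hc : c ≠ 0) : p ∈ Pset γ δ := by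
  obtain ⟨hs, ht⟩ := h
  have hmem : tfMon γ δ ∈ p.support := by
    rw [mem_support_iff, ht]
    exact hc
  refine ⟨?_, ?_, ?_, hmem, ?_⟩
  · rintro rfl
    simp at hmem
  · exact Finset.sup_le fun m hm => (hs m hm).1
  · exact Finset.sup_le fun m hm => (hs m hm).2
  · intro m hm hne
    obtain ⟨b1, b2⟩ := hs m hm
    rw [weight_w1_apply] at b1
    rw [weight_w2_apply] at b2
    obtain ⟨e0, e1, e2, e3, e4, e5⟩ := tfMon_apply γ δ
    by_cases h5 : m 5 < γ
    · left
      rw [e5]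
      exact h5
    · right
      refine ⟨by omega, 4, ?_, ?_⟩
      · intro l hl
        fin_cases l
        · change m 0 = tfMon γ δ 0
          omega
        · change m 1 = tfMon γ δ 1
          omega
        · change m 2 = tfMon γ δ 2
          omega
        · change m 3 = tfMon γ δ 3
          omega
        · exact absurd hl (lt_irrefl _)
      · change m 4 < tfMon γ δ 4
        rw [e4]
        refine lt_of_le_of_ne b2 fun h4 => hne ?_
        exact eq_tfMon (by omega) (by omega) (by omega) (by omega) h4 (by omega)

lemma of_eq (h : HasTop γ δ c p) (hc : c = c') : HasTop γ δ c' p := hc ▸ h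

lemma add (hp : HasTop γ δ c p) (hq : HasTop γ δ c' q) : HasTop γ δ (c + c') (p + q) := by
  classical
  refine ⟨fun m hm => ?_, by rw [coeff_add, hp.2, hq.2]⟩
  rcases Finset.mem_union.1 (support_add hm) with h | h
  exacts [hp.1 m h, hq.1 m h]

lemma add_low (hp : HasTop γ δ c p) (hq : HasTop γ δ 0 q) : HasTop γ δ c (p + q) :=
  (hp.add hq).of_eq (add_zero c)

lemma low_add (hp : HasTop γ δ 0 p) (hq : HasTop γ δ c q) : HasTop γ δ c (p + q) :=
  (hp.add hq).of_eq (zero_add c)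

lemma mul (hp : HasTop γ δ c p) (hq : HasTop γ' δ' c' q) :
    HasTop (γ + γ') (δ + δ') (c * c') (p * q) := by
  classical
  constructor
  · intro m hm
    obtain ⟨a, ha, b, hb, rfl⟩ := Finset.mem_add.1 (support_mul p q hm)
    have h1 := hp.1 a ha
    have h2 := hq.1 b hb
    simp only [map_add]
    omega
  · rw [coeff_mul, Finset.sum_eq_single (tfMon γ δ, tfMon γ' δ'), hp.2, hq.2]
    · rintro ⟨a, b⟩ hab hne
      rw [Finset.HasAntidiagonal.mem_antidiagonal] at hab
      by_contra h0
      have ha : a ∈ p.support := mem_support_iff.2 (left_ne_zero_of_mul h0)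
      have hb : b ∈ q.support := mem_support_iff.2 (right_ne_zero_of_mul h0)
      have h1 := hp.1 a ha
      have h2 := hq.1 b hb
      simp only [weight_w1_apply, weight_w2_apply] at h1 h2
      obtain ⟨e0, e1, e2, e3, e4, e5⟩ := tfMon_apply (γ + γ') (δ + δ')
      rw [← hab] at e0 e1 e2 e3 e4 e5
      simp only [Finsupp.add_apply] at e0 e1 e2 e3 e4 e5
      apply hne
      rw [Prod.mk.injEq]
      exact ⟨eq_tfMon (by omega) (by omega) (by omega) (by omega) (by omega) (by omega),
        eq_tfMon (by omega) (by omega) (by omega) (by omega) (by omega) (by omega)⟩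
    · intro h
      exact absurd (Finset.HasAntidiagonal.mem_antidiagonal.2 (tfMon_add γ δ γ' δ').symm) h

lemma low (hp : HasTop γ δ c p) (h1 : γ ≤ γ') (h2 : δ ≤ δ') (h3 : γ < γ' ∨ δ < δ') :
    HasTop γ' δ' 0 p := by
  refine ⟨fun m hm => ⟨(hp.1 m hm).1.trans h1, (hp.1 m hm).2.trans h2⟩, ?_⟩
  by_contra h0
  have := hp.1 _ (mem_support_iff.2 h0)
  simp only [weight_w1_apply, weight_w2_apply] at this
  obtain ⟨e0, e1, e2, e3, e4, e5⟩ := tfMon_apply γ' δ'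
  omega

lemma const (a : k) : HasTop 0 0 a (C a : MvPolynomial (Fin 6) k) := by
  classical
  refine ⟨fun m hm => ?_, by simp [tfMon]⟩
  have : m = 0 := by
    by_contra h
    rw [mem_support_iff, coeff_C, if_neg (Ne.symm h)] at hm
    exact hm rfl
  simp [this]

lemma C_mul (a : k) (hp : HasTop γ δ c p) : HasTop γ δ (a * c) (C a * p) := by
  simpa using (const a).mul hp

lemma C_mul_low (a : k) (hp : HasTop γ δ 0 p) : HasTop γ δ 0 (C a * p) :=
  (hp.C_mul a).of_eq (mul_zero a)

lemma pow (hp : HasTop γ δ c p) (n : ℕ) : HasTop (n * γ) (n * δ) (c ^ n) (p ^ n) := by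
  induction n with
  | zero => simpa using const (1 : k)
  | succ n ih => simpa [pow_succ, add_mul] using ih.mul hp

lemma of_X (i : Fin 6) (γ δ : ℕ) (h1 : w1 i = γ) (h2 : w2 i = δ) (c : k)
    (hc : coeff (tfMon γ δ) (X i : MvPolynomial (Fin 6) k) = c) :
    HasTop γ δ c (X i : MvPolynomial (Fin 6) k) := by
  refine ⟨fun m hm => ?_, hc⟩
  rw [support_X, Finset.mem_singleton] at hm
  subst hm
  simp [Finsupp.weight_single, h1, h2]

end HasTop

lemma hasTop_X0 : HasTop 1 0 (0 : k) (X 0) :=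
  .of_X 0 1 0 rfl rfl 0 (by simp [coeff_X, tfMon, Finsupp.single_left_inj])
lemma hasTop_X1 : HasTop 2 0 (0 : k) (X 1) :=
  .of_X 1 2 0 rfl rfl 0 (by simp [coeff_X, tfMon, Finsupp.single_eq_single_iff])
lemma hasTop_X2 : HasTop 3 0 (0 : k) (X 2) :=
  .of_X 2 3 0 rfl rfl 0 (by simp [coeff_X, tfMon, Finsupp.single_eq_single_iff])
lemma hasTop_X3 : HasTop 1 0 (0 : k) (X 3) :=
  .of_X 3 1 0 rfl rfl 0 (by simp [coeff_X, tfMon, Finsupp.single_eq_single_iff])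
lemma hasTop_X4 : HasTop 0 1 (1 : k) (X 4) :=
  .of_X 4 0 1 rfl rfl 1 (by simp [tfMon])
lemma hasTop_X5 : HasTop 1 0 (1 : k) (X 5) :=
  .of_X 5 1 0 rfl rfl 1 (by simp [tfMon])

/-! ### The images of the variables under `exp (uΔ')` -/

/-- `u Δ'` as a bundled derivation. -/
def delDer (u : k) : Derivation k (MvPolynomial (Fin 6) k) (MvPolynomial (Fin 6) k) :=
  u • ((-(2 * X 3 * X 4) : MvPolynomial (Fin 6) k) • pderiv 0 +
    (4 * X 0 * X 3 - X 5 : MvPolynomial (Fin 6) k) • pderiv 1 +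
    (6 * X 1 * X 3 + 2 * X 4 ^ 2 : MvPolynomial (Fin 6) k) • pderiv 2 +
    (-(X 4 * X 5) : MvPolynomial (Fin 6) k) • pderiv 3)

lemma delDer_apply (u : k) (p : MvPolynomial (Fin 6) k) : delDer u p = u • Del' p := rfl

lemma delDer_X (u : k) :
    delDer u (X 0) = C u * -(2 * X 3 * X 4) ∧
    delDer u (X 1) = C u * (4 * X 0 * X 3 - X 5) ∧
    delDer u (X 2) = C u * (6 * X 1 * X 3 + 2 * X 4 ^ 2) ∧
    delDer u (X 3) = C u * -(X 4 * X 5) ∧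
    delDer u (X 4) = 0 ∧ delDer u (X 5) = 0 := by
  refine ⟨?_, ?_, ?_, ?_, ?_, ?_⟩ <;>
    simp [delDer_apply, Del', smul_eq_C_mul, pderiv_X, mul_add]

/-- If `D (E i) = (i + 1) E (i + 1)` and `E N = 0`, then `exp D (E 0) = ∑ i < N, E i`. -/
lemma IsExpOf.apply_eq_sum [CharZero k] {σ : Type*}
    {D : MvPolynomial σ k →ₗ[k] MvPolynomial σ k} {φ : MvPolynomial σ k ≃ₐ[k] MvPolynomial σ k}
    (hφ : IsExpOf D φ) (E : ℕ → MvPolynomial σ k) (N : ℕ)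
    (hE : ∀ i < N, D (E i) = ((i : k) + 1) • E (i + 1)) (hN : E N = 0) :
    φ (E 0) = ∑ i ∈ Finset.range N, E i := by
  have key : ∀ i ≤ N, D^[i] (E 0) = (i.factorial : k) • E i := by
    intro i
    induction i with
    | zero => simp
    | succ i ih =>
      intro hi
      rw [Function.iterate_succ_apply', ih (by omega), map_smul, hE i (by omega), smul_smul,
        Nat.factorial_succ]
      push_cast
      rw [mul_comm]
  rw [hφ (E 0) N (by rw [key N le_rfl, hN, smul_zero])]
  refine Finset.sum_congr rfl fun i hi => ?_
  rw [key i (Finset.mem_range.1 hi).le, smul_smul, inv_mul_cancel₀, one_smul]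
  exact_mod_cast i.factorial_ne_zero

lemma delDer_ofNat (u : k) (n : ℕ) [n.AtLeastTwo] :
    delDer u (ofNat(n) : MvPolynomial (Fin 6) k) = 0 := by
  rw [← map_ofNat (C : k →+* MvPolynomial (Fin 6) k) n, derivation_C]

section Images

variable [CharZero k] {u : k} {φ' : MvPolynomial (Fin 6) k ≃ₐ[k] MvPolynomial (Fin 6) k}

lemma exp_apply_X4 (hφ' : IsExpOf (fun p => u • Del' p) φ') : φ' (X 4) = X 4 := by
  obtain ⟨-, -, -, -, e4, -⟩ := delDer_X u
  have := IsExpOf.apply_eq_sum (D := (delDer u).toLinearMap) hφ'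
    (fun i => [X 4].getD i 0) 1 (by
      intro i hi
      interval_cases i
      simpa using e4) (by simp)
  simpa using this

lemma exp_apply_X0 (hφ' : IsExpOf (fun p => u • Del' p) φ') :
    φ' (X 0) = X 0 - 2 * C u * X 3 * X 4 + C u ^ 2 * X 4 ^ 2 * X 5 := by
  obtain ⟨e0, -, -, e3, e4, e5⟩ := delDer_X u
  have := IsExpOf.apply_eq_sum (D := (delDer u).toLinearMap) hφ'
    (fun i => [X 0, -(2 * C u * X 3 * X 4), C u ^ 2 * X 4 ^ 2 * X 5].getD i 0) 3 (by
      intro i hi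
      interval_cases i <;>
        simp [Derivation.leibniz, Derivation.leibniz_pow, e0, e3, e4, e5, delDer_ofNat,
          smul_eq_C_mul] <;> ring) (by simp)
  simp [Finset.sum_range_succ] at this
  rw [this]
  ring

lemma exp_apply_X1 (hφ' : IsExpOf (fun p => u • Del' p) φ') :
    φ' (X 1) = X 1 + C u * (4 * X 0 * X 3 - X 5) -
      C u ^ 2 * (4 * X 3 ^ 2 * X 4 + 2 * X 0 * X 4 * X 5) +
      4 * C u ^ 3 * X 3 * X 4 ^ 2 * X 5 - C u ^ 4 * X 4 ^ 3 * X 5 ^ 2 := by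
  obtain ⟨e0, e1, -, e3, e4, e5⟩ := delDer_X u
  have := IsExpOf.apply_eq_sum (D := (delDer u).toLinearMap) hφ'
    (fun i => [X 1, C u * (4 * X 0 * X 3 - X 5),
      -(C u ^ 2 * (4 * X 3 ^ 2 * X 4 + 2 * X 0 * X 4 * X 5)),
      4 * C u ^ 3 * X 3 * X 4 ^ 2 * X 5, -(C u ^ 4 * X 4 ^ 3 * X 5 ^ 2)].getD i 0) 5 (by
      intro i hi
      interval_cases i <;>
        simp [Derivation.leibniz, Derivation.leibniz_pow, e0, e1, e3, e4, e5, delDer_ofNat,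
          smul_eq_C_mul, map_ofNat C] <;> ring) (by simp)
  simp [Finset.sum_range_succ] at this
  rw [this]
  ring

lemma exp_apply_X2 (hφ' : IsExpOf (fun p => u • Del' p) φ') :
    φ' (X 2) = X 2 + C u * (6 * X 1 * X 3 + 2 * X 4 ^ 2) +
      C u ^ 2 * (12 * X 0 * X 3 ^ 2 - 3 * X 3 * X 5 - 3 * X 1 * X 4 * X 5) +
      C u ^ 3 * (2 * X 4 * X 5 ^ 2 - 8 * X 3 ^ 3 * X 4 - 12 * X 0 * X 3 * X 4 * X 5) +
      C u ^ 4 * (12 * X 3 ^ 2 * X 4 ^ 2 * X 5 + 3 * X 0 * X 4 ^ 2 * X 5 ^ 2) -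
      6 * C u ^ 5 * X 3 * X 4 ^ 3 * X 5 ^ 2 + C u ^ 6 * X 4 ^ 4 * X 5 ^ 3 := by
  obtain ⟨e0, e1, e2, e3, e4, e5⟩ := delDer_X u
  have := IsExpOf.apply_eq_sum (D := (delDer u).toLinearMap) hφ'
    (fun i => [X 2, C u * (6 * X 1 * X 3 + 2 * X 4 ^ 2),
      C u ^ 2 * (12 * X 0 * X 3 ^ 2 - 3 * X 3 * X 5 - 3 * X 1 * X 4 * X 5),
      C u ^ 3 * (2 * X 4 * X 5 ^ 2 - 8 * X 3 ^ 3 * X 4 - 12 * X 0 * X 3 * X 4 * X 5),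
      C u ^ 4 * (12 * X 3 ^ 2 * X 4 ^ 2 * X 5 + 3 * X 0 * X 4 ^ 2 * X 5 ^ 2),
      -(6 * C u ^ 5 * X 3 * X 4 ^ 3 * X 5 ^ 2), C u ^ 6 * X 4 ^ 4 * X 5 ^ 3].getD i 0) 7 (by
      intro i hi
      interval_cases i <;>
        simp [Derivation.leibniz, Derivation.leibniz_pow, e0, e1, e2, e3, e4, e5, delDer_ofNat,
          smul_eq_C_mul, map_ofNat C] <;> ring) (by simp)
  simp [Finset.sum_range_succ] at this
  rw [this]
  ring

end Images

lemma HasTop.low_monomial {γ δ : ℕ} (c : k) (n : Fin 6 → ℕ)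
    (h1 : n 0 + 2 * n 1 + 3 * n 2 + n 3 + n 5 ≤ γ) (h2 : n 4 ≤ δ)
    (h3 : n 0 + n 1 + n 2 + n 3 ≠ 0 ∨ n 5 < γ ∨ n 4 < δ) :
    HasTop γ δ 0
      (C c * (X 0 ^ n 0 * X 1 ^ n 1 * X 2 ^ n 2 * X 3 ^ n 3 * X 4 ^ n 4 * X 5 ^ n 5)) := by
  have h := ((((((hasTop_X0.pow (n 0)).mul (hasTop_X1.pow (n 1))).mul
    (hasTop_X2.pow (n 2))).mul (hasTop_X3.pow (n 3))).mul
    (hasTop_X4.pow (n 4))).mul (hasTop_X5.pow (n 5))).C_mul c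
  by_cases hs : n 0 + n 1 + n 2 + n 3 = 0
  · refine h.low ?_ ?_ ?_ <;> ring_nf at * <;> omega
  · by_cases hlt : n 0 + 2 * n 1 + 3 * n 2 + n 3 + n 5 < γ ∨ n 4 < δ
    · refine h.low ?_ ?_ ?_ <;> ring_nf at * <;> omega
    · have e1 : n 0 * 1 + n 1 * 2 + n 2 * 3 + n 3 * 1 + n 4 * 0 + n 5 * 1 = γ := by omega
      have e2 : n 0 * 0 + n 1 * 0 + n 2 * 0 + n 3 * 0 + n 4 * 1 + n 5 * 0 = δ := by omega
      rw [e1, e2] at h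
      refine h.of_eq ?_
      simp only [← pow_add, zero_pow hs]
      ring

/-- Elements which have top coefficients like the images of `x1, x2, x3, t_f` under
`exp (uΔ')`. -/
structure Frame (u : k) (y1 y2 y3 t : MvPolynomial (Fin 6) k) : Prop where
  top1 : HasTop 1 2 (u ^ 2) y1
  top2 : HasTop 2 3 (-u ^ 4) y2
  top3 : HasTop 3 4 (u ^ 6) y3
  topt : HasTop 0 1 1 t
  cancel : HasTop 3 4 0 (y1 * y2 + y3 * t)

lemma exp_frame [CharZero k] {u : k}
    {φ' : MvPolynomial (Fin 6) k ≃ₐ[k] MvPolynomial (Fin 6) k}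
    (hφ' : IsExpOf (fun p => u • Del' p) φ') :
    Frame u (φ' (X 0)) (φ' (X 1)) (φ' (X 2)) (φ' (X 4)) := by
  obtain ⟨l1, hl1, hy1⟩ : ∃ l1, HasTop 1 1 (0 : k) l1 ∧
      φ' (X 0) = C (u ^ 2) * (X 4 ^ 2 * X 5) + l1 := by
    refine ⟨_, ?_, eq_add_of_sub_eq' rfl⟩
    convert (HasTop.low_monomial (γ := 1) (δ := 1) (1 : k) ![1, 0, 0, 0, 0, 0]
      (by decide) (by decide) (by decide)).add_low
      (HasTop.low_monomial (-2 * u) ![0, 0, 0, 1, 1, 0] (by decide) (by decide) (by decide))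
      using 1
    rw [exp_apply_X0 hφ']
    simp [map_ofNat C]
    ring
  obtain ⟨l2, hl2, hy2⟩ : ∃ l2, HasTop 2 2 (0 : k) l2 ∧
      φ' (X 1) = C (-u ^ 4) * (X 4 ^ 3 * X 5 ^ 2) + l2 := by
    refine ⟨_, ?_, eq_add_of_sub_eq' rfl⟩
    convert ((((((HasTop.low_monomial (γ := 2) (δ := 2) (1 : k) ![0, 1, 0, 0, 0, 0]
      (by decide) (by decide) (by decide)).add_low
      (HasTop.low_monomial (4 * u) ![1, 0, 0, 1, 0, 0] (by decide) (by decide) (by decide))).add_low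
      (HasTop.low_monomial (-u) ![0, 0, 0, 0, 0, 1] (by decide) (by decide) (by decide))).add_low
      (HasTop.low_monomial (-4 * u ^ 2) ![0, 0, 0, 2, 1, 0]
        (by decide) (by decide) (by decide))).add_low
      (HasTop.low_monomial (-2 * u ^ 2) ![1, 0, 0, 0, 1, 1]
        (by decide) (by decide) (by decide))).add_low
      (HasTop.low_monomial (4 * u ^ 3) ![0, 0, 0, 1, 2, 1]
        (by decide) (by decide) (by decide)))
      using 1
    rw [exp_apply_X1 hφ']
    simp [map_ofNat C]
    ring
  obtain ⟨l3, hl3, hy3⟩ : ∃ l3, HasTop 3 3 (0 : k) l3 ∧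
      φ' (X 2) = C (u ^ 6) * (X 4 ^ 4 * X 5 ^ 3) + l3 := by
    refine ⟨_, ?_, eq_add_of_sub_eq' rfl⟩
    convert ((((((((((((HasTop.low_monomial (γ := 3) (δ := 3) (1 : k) ![0, 0, 1, 0, 0, 0]
      (by decide) (by decide) (by decide)).add_low
      (HasTop.low_monomial (6 * u) ![0, 1, 0, 1, 0, 0] (by decide) (by decide) (by decide))).add_low
      (HasTop.low_monomial (2 * u) ![0, 0, 0, 0, 2, 0] (by decide) (by decide) (by decide))).add_low
      (HasTop.low_monomial (12 * u ^ 2) ![1, 0, 0, 2, 0, 0]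
        (by decide) (by decide) (by decide))).add_low
      (HasTop.low_monomial (-3 * u ^ 2) ![0, 0, 0, 1, 0, 1]
        (by decide) (by decide) (by decide))).add_low
      (HasTop.low_monomial (-3 * u ^ 2) ![0, 1, 0, 0, 1, 1]
        (by decide) (by decide) (by decide))).add_low
      (HasTop.low_monomial (2 * u ^ 3) ![0, 0, 0, 0, 1, 2]
        (by decide) (by decide) (by decide))).add_low
      (HasTop.low_monomial (-8 * u ^ 3) ![0, 0, 0, 3, 1, 0]
        (by decide) (by decide) (by decide))).add_low
      (HasTop.low_monomial (-12 * u ^ 3) ![1, 0, 0, 1, 1, 1]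
        (by decide) (by decide) (by decide))).add_low
      (HasTop.low_monomial (12 * u ^ 4) ![0, 0, 0, 2, 2, 1]
        (by decide) (by decide) (by decide))).add_low
      (HasTop.low_monomial (3 * u ^ 4) ![1, 0, 0, 0, 2, 2]
        (by decide) (by decide) (by decide))).add_low
      (HasTop.low_monomial (-6 * u ^ 5) ![0, 0, 0, 1, 3, 2]
        (by decide) (by decide) (by decide)))
      using 1
    rw [exp_apply_X2 hφ']
    simp [map_ofNat C]
    ring
  have ht : HasTop 0 1 (1 : k) (φ' (X 4)) := by
    rw [exp_apply_X4 hφ']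
    exact hasTop_X4
  have t1 : HasTop 1 2 (u ^ 2) (C (u ^ 2) * (X 4 ^ 2 * X 5)) :=
    (((hasTop_X4.pow 2).mul hasTop_X5).C_mul _).of_eq (by ring)
  have t2 : HasTop 2 3 (-u ^ 4) (C (-u ^ 4) * (X 4 ^ 3 * X 5 ^ 2)) :=
    (((hasTop_X4.pow 3).mul (hasTop_X5.pow 2)).C_mul _).of_eq (by ring)
  have t3 : HasTop 3 4 (u ^ 6) (C (u ^ 6) * (X 4 ^ 4 * X 5 ^ 3)) :=
    (((hasTop_X4.pow 4).mul (hasTop_X5.pow 3)).C_mul _).of_eq (by ring)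
  refine ⟨?_, ?_, ?_, ht, ?_⟩
  · rw [hy1]
    exact t1.add_low (hl1.low (by decide) (by decide) (by decide))
  · rw [hy2]
    exact t2.add_low (hl2.low (by decide) (by decide) (by decide))
  · rw [hy3]
    exact t3.add_low (hl3.low (by decide) (by decide) (by decide))
  · have e : φ' (X 0) * φ' (X 1) + φ' (X 2) * φ' (X 4) =
        C (u ^ 2) * (X 4 ^ 2 * X 5) * l2 + l1 * (C (-u ^ 4) * (X 4 ^ 3 * X 5 ^ 2)) + l1 * l2 +
          l3 * X 4 := by
      rw [hy1, hy2, hy3, exp_apply_X4 hφ']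
      simp only [map_neg, map_pow]
      ring
    rw [e]
    refine (((HasTop.add_low ?_ ?_).add_low ?_).add_low ?_)
    · exact (t1.mul hl2).of_eq (mul_zero _)
    · exact (hl1.mul t2).of_eq (zero_mul _)
    · exact (hl1.mul hl2).low (by decide) (by decide) (by decide)
    · exact (hl3.mul hasTop_X4).of_eq (zero_mul _)

/-! ### Lifts -/

/-- The lift `α̂`, modified by multiples of `t_f - (x1*x3 - x2^2)`. -/
def corrLift (A : Matrix (Fin 3) (Fin 3) k) (d : Fin 3 → k) (ν p q : k) :
    MvPolynomial (Fin 6) k →ₐ[k] MvPolynomial (Fin 6) k :=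
  aeval ![affImg A d 0, affImg A d 1, affImg A d 2,
    affImg A d 1 * hatTf A d + affImg A d 0 ^ 2 + C ν * (X 4 - (X 0 * X 2 - X 1 ^ 2)),
    hatTf A d,
    affImg A d 2 * hatTf A d ^ 2 + 2 * affImg A d 0 * affImg A d 1 * hatTf A d +
      affImg A d 0 ^ 3 + (C p * X 2 + C q * X 1) * (X 4 - (X 0 * X 2 - X 1 ^ 2))]

lemma ι36_apply : ι36 0 = 0 ∧ ι36 1 = 1 ∧ ι36 2 = 2 := ⟨rfl, rfl, rfl⟩

lemma isLift_corrLift (α : MvPolynomial (Fin 3) k ≃ₐ[k] MvPolynomial (Fin 3) k)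
    (A : Matrix (Fin 3) (Fin 3) k) (d : Fin 3 → k)
    (hαA : ∀ i : Fin 3, α (X i) = (∑ j : Fin 3, C (A j i) * X j) + C (d i)) (ν p q : k) :
    IsLift α (corrLift A d ν p q) := by
  obtain ⟨i0, i1, i2⟩ := ι36_apply
  have himg : ∀ i, embP (α (X i)) = affImg A d i := by
    intro i
    simp [hαA, embP, affImg]
  have hpi : ∀ i, piMap (affImg A d i) = α (X i) := by
    intro i
    simp [hαA, affImg, Fin.sum_univ_three, i0, i1, i2, piMap, algHom_C]
  have hf : piMap (X 4 - (X 0 * X 2 - X 1 ^ 2) : MvPolynomial (Fin 6) k) = 0 := by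
    simp [piMap, fP]
  have htf : piMap (hatTf A d) = α fP := by
    rw [hatTf, map_add, map_mul, hf]
    simp [hpi, fP]
  constructor
  · intro i
    rw [himg]
    fin_cases i
    · simp [corrLift, i0]
    · simp [corrLift, i1]
    · simp [corrLift, i2]
  · intro P
    have : (piMap.comp (corrLift A d ν p q)) = (α : _ →ₐ[k] _).comp piMap := by
      apply MvPolynomial.algHom_ext
      intro i
      fin_cases i
      · simp [corrLift, hpi]
        simp [piMap]
      · simp [corrLift, hpi]
        simp [piMap]
      · simp [corrLift, hpi]
        simp [piMap]
      · simp only [corrLift, AlgHom.comp_apply, aeval_X]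
        change piMap (_ * _ + _ ^ 2 + _ * _) = _
        rw [map_add, map_mul (piMap) (C ν), hf]
        simp [hpi, htf]
        simp [piMap, rP]
      · simp [corrLift, htf]
        simp [piMap]
      · simp only [corrLift, AlgHom.comp_apply, aeval_X]
        change piMap (_ * _ ^ 2 + _ + _ ^ 3 + _ * _) = _
        rw [map_add, map_mul (piMap) (_ + _), hf]
        simp [hpi, htf, map_ofNat]
        simp [piMap, gP, map_ofNat]
    exact DFunLike.congr_fun this P

/-! ### Scalar identities -/

lemma det_sq_eq (A : Matrix (Fin 3) (Fin 3) k) [CharZero k]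
    (h33 : A 2 0 * A 2 2 - A 2 1 ^ 2 = 0)
    (h23 : A 1 0 * A 2 2 + A 2 0 * A 1 2 - 2 * A 1 1 * A 2 1 = 0) :
    A.det ^ 2 = -((A 1 0 * A 1 2 - A 1 1 ^ 2) *
      (A 0 0 * A 2 2 - 2 * (A 0 1 * A 2 1) + A 0 2 * A 2 0) ^ 2) := by
  have h2 : (2 : k) ≠ 0 := two_ne_zero
  apply mul_left_cancel₀ h2
  rw [Matrix.det_fin_three]
  linear_combination
    (8 * (A 0 0 * A 0 2 - A 0 1 ^ 2) * (A 1 0 * A 1 2 - A 1 1 ^ 2)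
      - 2 * (A 0 0 * A 1 2 + A 1 0 * A 0 2 - 2 * A 0 1 * A 1 1) ^ 2) * h33
    + (2 * (A 0 0 * A 1 2 + A 1 0 * A 0 2 - 2 * A 0 1 * A 1 1) *
        (A 0 0 * A 2 2 - 2 * (A 0 1 * A 2 1) + A 0 2 * A 2 0)
      - 2 * (A 0 0 * A 0 2 - A 0 1 ^ 2) *
        (A 1 0 * A 2 2 + A 2 0 * A 1 2 - 2 * A 1 1 * A 2 1)) * h23

/-- A parametrization of the similitudes of the quadratic form `x1*x3 - x2^2`. -/
lemma exists_similitude_param [CharZero k] {a11 a12 a13 a21 a22 a23 a31 a32 a33 : k}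
    (n31 : a31 ≠ 0) (n32 : a32 ≠ 0)
    (h33 : a31 * a33 - a32 ^ 2 = 0)
    (h23 : a21 * a33 + a31 * a23 - 2 * a22 * a32 = 0)
    (h13 : a11 * a33 - 2 * (a12 * a32) + a13 * a31 ≠ 0)
    (h22 : a21 * a23 - a22 ^ 2 + (a11 * a33 - 2 * (a12 * a32) + a13 * a31) = 0)
    (h12 : a11 * a23 + a21 * a13 - 2 * a12 * a22 = 0)
    (h11 : a11 * a13 - a12 ^ 2 = 0) :
    ∃ e a c : k, e ≠ 0 ∧ a * e - c ≠ 0 ∧ a32 = a31 * e ∧ a33 = a31 * e ^ 2 ∧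
      a21 = 2 * a31 * a ∧ a22 = a31 * (a * e + c) ∧ a23 = 2 * a31 * c * e ∧
      a11 = a31 * a ^ 2 ∧ a12 = a31 * a * c ∧ a13 = a31 * c ^ 2 := by
  obtain ⟨e, he⟩ : ∃ e, a32 = a31 * e := ⟨a32 / a31, by field_simp⟩
  obtain ⟨a, ha⟩ : ∃ a, a21 = 2 * a31 * a := ⟨a21 / (2 * a31), by field_simp⟩
  obtain ⟨c, hc⟩ : ∃ c, a22 = a31 * (a * e + c) := ⟨a22 / a31 - a * e, by field_simp; ring⟩
  subst he ha hc
  have ne : e ≠ 0 := right_ne_zero_of_mul n32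
  have e33 : a33 = a31 * e ^ 2 := by
    apply mul_left_cancel₀ n31
    linear_combination h33
  subst e33
  have e23 : a23 = 2 * a31 * c * e := by
    apply mul_left_cancel₀ n31
    linear_combination h23
  subst e23
  have hq : a11 * (a31 * e ^ 2) - 2 * (a12 * (a31 * e)) + a13 * a31 =
      a31 ^ 2 * (a * e - c) ^ 2 := by linear_combination h22
  have hD : a * e - c ≠ 0 := by
    intro h
    rw [hq, h] at h13
    simp at h13
  obtain ⟨z1, rfl⟩ : ∃ z, a11 = a31 * a ^ 2 + z := ⟨a11 - a31 * a ^ 2, by ring⟩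
  obtain ⟨z2, rfl⟩ : ∃ z, a12 = a31 * a * c + z := ⟨a12 - a31 * a * c, by ring⟩
  obtain ⟨z3, rfl⟩ : ∃ z, a13 = a31 * c ^ 2 + z := ⟨a13 - a31 * c ^ 2, by ring⟩
  have e3 : z3 = 2 * z2 * e - z1 * e ^ 2 := by
    apply mul_left_cancel₀ n31
    linear_combination hq
  subst e3
  have e2 : z2 = e * z1 := by
    apply mul_left_cancel₀ (mul_ne_zero (mul_ne_zero two_ne_zero n31) hD)
    linear_combination h12
  subst e2
  have e1 : z1 = 0 := by
    apply mul_left_cancel₀ (mul_ne_zero n31 (pow_ne_zero 2 hD))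
    linear_combination h11
  subst e1
  exact ⟨e, a, c, ne, hD, rfl, rfl, rfl, rfl, rfl, by ring, by ring, by ring⟩

lemma bracket_eq {a31 a32 a33 c3 : k} (n31 : a31 ≠ 0) (n32 : a32 ≠ 0)
    (h33 : a31 * a33 - a32 ^ 2 = 0) (hρ : a32 * c3 + a31 ^ 2 = 0) (x1 x2 x3 : k) :
    c3 ^ 2 * x3 + 2 * c3 * (a31 * x2 + a32 * x1) + 3 * a31 ^ 2 * x1 =
      a31 ^ 3 / a32 ^ 2 * (x1 * a33 - 2 * (x2 * a32) + x3 * a31) := by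
  have e3 : c3 = -a31 ^ 2 / a32 := by
    field_simp
    linear_combination hρ
  have e33 : a33 = a32 ^ 2 / a31 := by
    field_simp
    linear_combination h33
  subst e3 e33
  field_simp
  ring

lemma sq_eps_eq [CharZero k] {a11 a12 a13 a21 a22 a23 a31 a32 a33 c2 c3 : k}
    (n31 : a31 ≠ 0) (n32 : a32 ≠ 0)
    (h33 : a31 * a33 - a32 ^ 2 = 0)
    (h23 : a21 * a33 + a31 * a23 - 2 * a22 * a32 = 0)
    (h13 : a11 * a33 - 2 * (a12 * a32) + a13 * a31 ≠ 0)
    (h22 : a21 * a23 - a22 ^ 2 + (a11 * a33 - 2 * (a12 * a32) + a13 * a31) = 0)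
    (h12 : a11 * a23 + a21 * a13 - 2 * a12 * a22 = 0)
    (h11 : a11 * a13 - a12 ^ 2 = 0)
    (hρ : a32 * c3 + a31 ^ 2 = 0) :
    a31 * (a33 * c2 ^ 2 + 2 * a23 * c3 * c2 + 2 * ((a31 * a22 + a32 * a21) * c2 + a21 * a22 * c3) +
      3 * a31 * a21 ^ 2 + a31 ^ 3 / a32 ^ 2 * (a11 * a33 - 2 * (a12 * a32) + a13 * a31)) =
    (a32 * c2 + a22 * c3 + 2 * a31 * a21) ^ 2 := by
  obtain ⟨e, a, c, ne, -, rfl, rfl, rfl, rfl, rfl, rfl, rfl, rfl⟩ :=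
    exists_similitude_param n31 n32 h33 h23 h13 h22 h12 h11
  have e3 : c3 = -a31 / e := by
    field_simp
    apply mul_left_cancel₀ n31
    linear_combination hρ
  subst e3
  field_simp
  ring

lemma cubic_coeff_eq_zero [CharZero k] {a11 a12 a13 a21 a22 a23 a31 a32 a33 c1 c2 c3 : k}
    (n31 : a31 ≠ 0) (n32 : a32 ≠ 0)
    (h33 : a31 * a33 - a32 ^ 2 = 0)
    (h23 : a21 * a33 + a31 * a23 - 2 * a22 * a32 = 0)
    (h13 : a11 * a33 - 2 * (a12 * a32) + a13 * a31 ≠ 0)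
    (h22 : a21 * a23 - a22 ^ 2 + (a11 * a33 - 2 * (a12 * a32) + a13 * a31) = 0)
    (h12 : a11 * a23 + a21 * a13 - 2 * a12 * a22 = 0)
    (h11 : a11 * a13 - a12 ^ 2 = 0)
    (hρ : a32 * c3 + a31 ^ 2 = 0) (hε : a32 * c2 + a22 * c3 + 2 * a31 * a21 = 0) :
    (2 * a33 * c1 * c2 + 2 * c3 * (a23 * c1 + a13 * c2) +
      2 * ((a31 * a22 + a32 * a21) * c1 + (a31 * a12 + a32 * a11) * c2 +
        (a11 * a22 + a21 * a12) * c3) + 6 * a31 * a11 * a21) +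
      (a23 * c2 ^ 2 + 2 * a21 * a22 * c2 + a21 ^ 3) = 0 := by
  obtain ⟨e, a, c, ne, -, rfl, rfl, rfl, rfl, rfl, rfl, rfl, rfl⟩ :=
    exists_similitude_param n31 n32 h33 h23 h13 h22 h12 h11
  have e3 : c3 = -a31 / e := by
    field_simp
    apply mul_left_cancel₀ n31
    linear_combination hρ
  subst e3
  have e2 : c2 = a31 * (c - 3 * a * e) / e ^ 2 := by
    field_simp at hε ⊢
    apply mul_left_cancel₀ n31
    linear_combination hε
  subst e2
  field_simp
  ring

lemma linear_coeff_ne_zero [CharZero k] {a11 a12 a13 a21 a22 a23 a31 a32 a33 d1 d2 d3 : k}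
    {c1 c2 c3 : k}
    (n31 : a31 ≠ 0) (n32 : a32 ≠ 0)
    (h33 : a31 * a33 - a32 ^ 2 = 0)
    (h23 : a21 * a33 + a31 * a23 - 2 * a22 * a32 = 0)
    (h13 : a11 * a33 - 2 * (a12 * a32) + a13 * a31 ≠ 0)
    (h22 : a21 * a23 - a22 ^ 2 + (a11 * a33 - 2 * (a12 * a32) + a13 * a31) = 0)
    (h12 : a11 * a23 + a21 * a13 - 2 * a12 * a22 = 0)
    (h11 : a11 * a13 - a12 ^ 2 = 0)
    (hc1 : c1 = d1 * a13 - 2 * (d2 * a12) + d3 * a11)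
    (hc2 : c2 = d1 * a23 - 2 * (d2 * a22) + d3 * a21)
    (hc3 : c3 = d1 * a33 - 2 * (d2 * a32) + d3 * a31)
    (hρ : a32 * c3 + a31 ^ 2 = 0) (hε : a32 * c2 + a22 * c3 + 2 * a31 * a21 = 0)
    (hκ : a32 * c1 + a12 * c3 + 2 * a31 * a11 + a22 * c2 + a21 ^ 2 = 0) :
    a32 * (d1 * d3 - d2 ^ 2) + c3 * d2 + 2 * a31 * d1 ≠ 0 := by
  obtain ⟨e, a, c, ne, hD, rfl, rfl, rfl, rfl, rfl, rfl, rfl, rfl⟩ :=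
    exists_similitude_param n31 n32 h33 h23 h13 h22 h12 h11
  subst hc1 hc2 hc3
  have ns2 : a31 ^ 2 ≠ 0 := pow_ne_zero 2 n31
  have e3 : d3 = -1 / e - e ^ 2 * d1 + 2 * e * d2 := by
    apply mul_left_cancel₀ ne
    field_simp
    apply mul_left_cancel₀ ns2
    linear_combination hρ
  subst e3
  have e2 : d2 = e * d1 - 1 / (2 * e ^ 2) := by
    apply mul_left_cancel₀ hD
    field_simp at hε ⊢
    apply mul_left_cancel₀ ns2
    linear_combination hε
  subst e2
  have e1 : d1 = -1 / e ^ 3 := by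
    apply mul_left_cancel₀ (mul_ne_zero ne (pow_ne_zero 2 hD))
    field_simp at hκ ⊢
    apply mul_left_cancel₀ ns2
    linear_combination hκ
  subst e1
  have : a31 * e * (-1 / e ^ 3 * (-1 / e - e ^ 2 * (-1 / e ^ 3) +
      2 * e * (e * (-1 / e ^ 3) - 1 / (2 * e ^ 2))) - (e * (-1 / e ^ 3) - 1 / (2 * e ^ 2)) ^ 2) +
      (-1 / e ^ 3 * (a31 * e ^ 2) - 2 * ((e * (-1 / e ^ 3) - 1 / (2 * e ^ 2)) * (a31 * e)) +
        (-1 / e - e ^ 2 * (-1 / e ^ 3) + 2 * e * (e * (-1 / e ^ 3) - 1 / (2 * e ^ 2))) * a31) *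
        (e * (-1 / e ^ 3) - 1 / (2 * e ^ 2)) + 2 * a31 * (-1 / e ^ 3) = a31 / (4 * e ^ 3) := by
    field_simp
    ring
  rw [this]
  exact div_ne_zero n31 (mul_ne_zero (by norm_num) (pow_ne_zero 3 ne))

section Core

/-! ### Top coefficients of the images of the lifts -/

variable {A : Matrix (Fin 3) (Fin 3) k} {d : Fin 3 → k} {u : k}
  {y1 y2 y3 t : MvPolynomial (Fin 6) k}

/-- The affine expression `∑ᵢ A i j * yᵢ + d j`. -/
def affAt (A : Matrix (Fin 3) (Fin 3) k) (d : Fin 3 → k) (y1 y2 y3 : MvPolynomial (Fin 6) k)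
    (j : Fin 3) : MvPolynomial (Fin 6) k :=
  C (A 0 j) * y1 + C (A 1 j) * y2 + C (A 2 j) * y3 + C (d j)

/-- The part of `affAt` without `y3`. -/
def affAtLow (A : Matrix (Fin 3) (Fin 3) k) (d : Fin 3 → k) (y1 y2 : MvPolynomial (Fin 6) k)
    (j : Fin 3) : MvPolynomial (Fin 6) k :=
  C (A 1 j) * y2 + C (A 0 j) * y1 + C (d j)

/-- The coefficient of `t_f - (x1*x3 - x2^2)` in `hatTf`. -/
def polar (A : Matrix (Fin 3) (Fin 3) k) : k :=
  A 0 0 * A 2 2 - 2 * (A 0 1 * A 2 1) + A 0 2 * A 2 0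

/-- The linear coefficients of `f` evaluated at an affine expression. -/
def linCoeff (A : Matrix (Fin 3) (Fin 3) k) (d : Fin 3 → k) (j : Fin 3) : k :=
  d 0 * A j 2 - 2 * (d 1 * A j 1) + d 2 * A j 0

/-- The image of `hatTf` in terms of the images of the variables. -/
def tfAt (A : Matrix (Fin 3) (Fin 3) k) (d : Fin 3 → k) (y1 y2 y3 t : MvPolynomial (Fin 6) k) :
    MvPolynomial (Fin 6) k :=
  (affAt A d y1 y2 y3 0 * affAt A d y1 y2 y3 2 - affAt A d y1 y2 y3 1 ^ 2) +
    C (polar A) * (t - (y1 * y3 - y2 ^ 2))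

lemma tfAt_eq : tfAt A d y1 y2 y3 t =
    C (A 2 0 * A 2 2 - A 2 1 ^ 2) * y3 ^ 2 +
    C (A 1 0 * A 2 2 + A 2 0 * A 1 2 - 2 * A 1 1 * A 2 1) * (y2 * y3) +
    C (A 1 0 * A 1 2 - A 1 1 ^ 2 + polar A) * y2 ^ 2 +
    C (A 0 0 * A 1 2 + A 1 0 * A 0 2 - 2 * A 0 1 * A 1 1) * (y1 * y2) +
    C (linCoeff A d 2) * y3 +
    (C (A 0 0 * A 0 2 - A 0 1 ^ 2) * y1 ^ 2 + C (linCoeff A d 1) * y2 +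
      (C (linCoeff A d 0) * y1 + C (polar A) * t + C (d 0 * d 2 - d 1 ^ 2))) := by
  simp only [tfAt, affAt, polar, linCoeff, map_add, map_mul, map_sub, map_pow, map_ofNat]
  ring

lemma affAt_eq (j : Fin 3) :
    affAt A d y1 y2 y3 j = C (A 2 j) * y3 + affAtLow A d y1 y2 j := by
  simp only [affAt, affAtLow]
  ring

lemma Frame.affAtLow (hf : Frame u y1 y2 y3 t) (j : Fin 3) :
    HasTop 2 3 (-(A 1 j * u ^ 4)) (affAtLow A d y1 y2 j) := by
  refine HasTop.add_low (HasTop.add_low ((hf.top2.C_mul _).of_eq (by ring)) ?_) ?_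
  · exact (hf.top1.C_mul _).low (by decide) (by decide) (by decide)
  · exact (HasTop.const _).low (by decide) (by decide) (by decide)

lemma Frame.affAt (hf : Frame u y1 y2 y3 t) (j : Fin 3) :
    HasTop 3 4 (A 2 j * u ^ 6) (affAt A d y1 y2 y3 j) := by
  rw [affAt_eq]
  exact (hf.top3.C_mul _).add_low ((hf.affAtLow j).low (by decide) (by decide) (by decide))

/-- Three polynomials have nonzero top coefficients with degrees as in condition (C). -/
def GoodTops (R F G : MvPolynomial (Fin 6) k) : Prop :=
  ∃ m4 m5 m6 n4 n5 n6 : ℕ, ∃ c4 c5 c6 : k,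
    HasTop m4 n4 c4 R ∧ HasTop m5 n5 c5 F ∧ HasTop m6 n6 c6 G ∧
    c4 ≠ 0 ∧ c5 ≠ 0 ∧ c6 ≠ 0 ∧ 1 ≤ n4 ∧ 1 ≤ n5 ∧ 3 ≤ m6 ∧ m4 ≤ m6 ∧ 5 ≤ n6 ∧ n4 + 1 ≤ n6

lemma goodTops_of_large {X1 X2 X3 F : MvPolynomial (Fin 6) k} {b1 b2 b3 c : k} {m n : ℕ}
    (h1 : HasTop 3 4 b1 X1) (h2 : HasTop 3 4 b2 X2) (h3 : HasTop 3 4 b3 X3)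
    (hF : HasTop m n c F) (hm : 3 ≤ m) (hn : 5 ≤ n) (n2 : b2 ≠ 0) (n3 : b3 ≠ 0) (nc : c ≠ 0) :
    GoodTops (X2 * F + X1 ^ 2) F (X3 * F ^ 2 + 2 * X1 * X2 * F + X1 ^ 3) := by
  refine ⟨3 + m, m, 3 + 2 * m, 4 + n, n, 4 + 2 * n, b2 * c, c, b3 * c ^ 2, ?_, hF, ?_,
    mul_ne_zero n2 nc, nc, mul_ne_zero n3 (pow_ne_zero 2 nc), by omega, by omega, by omega,
    by omega, by omega, by omega⟩
  · exact (h2.mul hF).add_low ((h1.pow 2).low (by omega) (by omega) (by omega))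
  · refine ((h3.mul (hF.pow 2)).add_low ?_).add_low
      ((h1.pow 3).low (by omega) (by omega) (by omega))
    have e : 2 * X1 * X2 * F = C 2 * (X1 * X2 * F) := by
      rw [map_ofNat]
      ring
    rw [e]
    exact (((h1.mul h2).mul hF).C_mul 2).low (by omega) (by omega) (by omega)

lemma goodTops_of_small {X1 X2 X3 F : MvPolynomial (Fin 6) k} {b1 b2 b3 c : k} {m n : ℕ}
    (h1 : HasTop 3 4 b1 X1) (h2 : HasTop 3 4 b2 X2) (h3 : HasTop 3 4 b3 X3)
    (hF : HasTop m n c F) (hm : m ≤ 2) (hn : n ≤ 4) (hn1 : 1 ≤ n) (n1 : b1 ≠ 0) (nc : c ≠ 0) :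
    GoodTops (X2 * F + X1 ^ 2) F (X3 * F ^ 2 + 2 * X1 * X2 * F + X1 ^ 3) := by
  refine ⟨6, m, 9, 8, n, 12, b1 ^ 2, c, b1 ^ 3, ?_, hF, ?_,
    pow_ne_zero 2 n1, nc, pow_ne_zero 3 n1, by omega, hn1, by omega,
    by omega, by omega, by omega⟩
  · exact HasTop.low_add ((h2.mul hF).low (by omega) (by omega) (by omega)) (h1.pow 2)
  · refine HasTop.low_add (HasTop.add_low
      ((h3.mul (hF.pow 2)).low (by omega) (by omega) (by omega)) ?_) (h1.pow 3)
    have e : 2 * X1 * X2 * F = C 2 * (X1 * X2 * F) := by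
      rw [map_ofNat]
      ring
    rw [e]
    exact (((h1.mul h2).mul hF).C_mul 2).low (by omega) (by omega) (by omega)

lemma goodTops_of_mid {X1 X2 X3 F : MvPolynomial (Fin 6) k} {b1 b2 b3 c : k}
    (h1 : HasTop 3 4 b1 X1) (h2 : HasTop 3 4 b2 X2) (h3 : HasTop 3 4 b3 X3)
    (hF : HasTop 3 4 c F) (hb : b1 * b3 = b2 ^ 2) (nc : c ≠ 0) (hρ : b2 * c + b1 ^ 2 ≠ 0) :
    GoodTops (X2 * F + X1 ^ 2) F (X3 * F ^ 2 + 2 * X1 * X2 * F + X1 ^ 3) := by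
  refine ⟨6, 3, 9, 8, 4, 12, b2 * c + b1 ^ 2, c, b3 * c ^ 2 + 2 * (b1 * b2 * c) + b1 ^ 3,
    (h2.mul hF).add (h1.pow 2), hF, ?_, hρ, nc, ?_, by decide, by decide, by decide,
    by decide, by decide, by decide⟩
  · refine (((h3.mul (hF.pow 2)).add ?_).add (h1.pow 3))
    have e : 2 * X1 * X2 * F = C 2 * (X1 * X2 * F) := by
      rw [map_ofNat]
      ring
    rw [e]
    exact ((h1.mul h2).mul hF).C_mul 2
  · intro h
    apply pow_ne_zero 2 hρ
    linear_combination b1 * h - c ^ 2 * hb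

lemma tfAt_top_large (hf : Frame u y1 y2 y3 t) (hu : u ≠ 0)
    (hne : ¬ (A 2 0 * A 2 2 - A 2 1 ^ 2 = 0 ∧
      A 1 0 * A 2 2 + A 2 0 * A 1 2 - 2 * A 1 1 * A 2 1 = 0 ∧
      A 1 0 * A 1 2 - A 1 1 ^ 2 + polar A = 0 ∧
      A 0 0 * A 1 2 + A 1 0 * A 0 2 - 2 * A 0 1 * A 1 1 = 0)) :
    ∃ m n c, HasTop m n c (tfAt A d y1 y2 y3 t) ∧ 3 ≤ m ∧ 5 ≤ n ∧ c ≠ 0 := by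
  rw [tfAt_eq]
  generalize A 2 0 * A 2 2 - A 2 1 ^ 2 = q33 at *
  generalize A 1 0 * A 2 2 + A 2 0 * A 1 2 - 2 * A 1 1 * A 2 1 = q23 at *
  generalize A 1 0 * A 1 2 - A 1 1 ^ 2 + polar A = q22 at *
  generalize A 0 0 * A 1 2 + A 1 0 * A 0 2 - 2 * A 0 1 * A 1 1 = q12 at *
  have t33 := (hf.top3.pow 2).C_mul q33
  have t23 := (hf.top2.mul hf.top3).C_mul q23
  have t22 := (hf.top2.pow 2).C_mul q22
  have t12 := (hf.top1.mul hf.top2).C_mul q12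
  have t3 := hf.top3.C_mul (linCoeff A d 2)
  have rest : HasTop 3 4 0 (C (A 0 0 * A 0 2 - A 0 1 ^ 2) * y1 ^ 2 + C (linCoeff A d 1) * y2 +
      (C (linCoeff A d 0) * y1 + C (polar A) * t + C (d 0 * d 2 - d 1 ^ 2))) := by
    refine HasTop.add_low (HasTop.add_low ?_ ?_) (HasTop.add_low (HasTop.add_low ?_ ?_) ?_)
    · exact ((hf.top1.pow 2).C_mul _).low (by decide) (by decide) (by decide)
    · exact (hf.top2.C_mul _).low (by decide) (by decide) (by decide)
    · exact (hf.top1.C_mul _).low (by decide) (by decide) (by decide)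
    · exact (hf.topt.C_mul _).low (by decide) (by decide) (by decide)
    · exact (HasTop.const _).low (by decide) (by decide) (by decide)
  by_cases h33 : q33 = 0
  swap
  · refine ⟨6, 8, _, HasTop.add_low (HasTop.add_low (HasTop.add_low (HasTop.add_low
      (HasTop.add_low t33 (t23.low ?_ ?_ ?_)) (t22.low ?_ ?_ ?_)) (t12.low ?_ ?_ ?_))
      (t3.low ?_ ?_ ?_)) (rest.low ?_ ?_ ?_), ?_, ?_,
      mul_ne_zero h33 (pow_ne_zero 2 (pow_ne_zero 6 hu))⟩ <;> decide
  by_cases h23 : q23 = 0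
  swap
  · simp only [h33, map_zero, zero_mul, zero_add]
    refine ⟨5, 7, _, HasTop.add_low (HasTop.add_low (HasTop.add_low (HasTop.add_low t23
      (t22.low ?_ ?_ ?_)) (t12.low ?_ ?_ ?_)) (t3.low ?_ ?_ ?_)) (rest.low ?_ ?_ ?_), ?_, ?_,
      mul_ne_zero h23 (mul_ne_zero (neg_ne_zero.2 (pow_ne_zero 4 hu)) (pow_ne_zero 6 hu))⟩ <;>
      decide
  by_cases h22 : q22 = 0
  swap
  · simp only [h33, h23, map_zero, zero_mul, zero_add]
    refine ⟨4, 6, _, HasTop.add_low (HasTop.add_low (HasTop.add_low t22 (t12.low ?_ ?_ ?_))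
      (t3.low ?_ ?_ ?_)) (rest.low ?_ ?_ ?_), ?_, ?_,
      mul_ne_zero h22 (pow_ne_zero 2 (neg_ne_zero.2 (pow_ne_zero 4 hu)))⟩ <;> decide
  by_cases h12 : q12 = 0
  swap
  · simp only [h33, h23, h22, map_zero, zero_mul, zero_add]
    refine ⟨3, 5, _, HasTop.add_low (HasTop.add_low t12 (t3.low ?_ ?_ ?_)) (rest.low ?_ ?_ ?_),
      ?_, ?_, mul_ne_zero h12 (mul_ne_zero (pow_ne_zero 2 hu)
        (neg_ne_zero.2 (pow_ne_zero 4 hu)))⟩ <;> decide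
  exact absurd ⟨h33, h23, h22, h12⟩ hne

lemma tfAt_top_small (hf : Frame u y1 y2 y3 t) (hu : u ≠ 0) {q11 c1 c2 q13 c0 : k}
    (h13 : q13 ≠ 0) :
    ∃ m n c, HasTop m n c (C q11 * y1 ^ 2 + C c2 * y2 + (C c1 * y1 + C q13 * t + C c0)) ∧
      m ≤ 2 ∧ n ≤ 4 ∧ 1 ≤ n ∧ c ≠ 0 := by
  have t11 := (hf.top1.pow 2).C_mul q11
  have t2 := hf.top2.C_mul c2
  have t1 := hf.top1.C_mul c1
  have tt := hf.topt.C_mul q13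
  have t0 := HasTop.const c0
  have rest := HasTop.add_low tt (t0.low (by decide) (by decide) (by decide))
  rw [add_assoc (C c1 * y1)]
  by_cases h11 : q11 = 0
  swap
  · refine ⟨2, 4, _, HasTop.add_low (HasTop.add_low t11 (t2.low ?_ ?_ ?_))
      (HasTop.add_low (t1.low ?_ ?_ ?_) (rest.low ?_ ?_ ?_)), ?_, ?_, ?_,
      mul_ne_zero h11 (pow_ne_zero 2 (pow_ne_zero 2 hu))⟩ <;> decide
  by_cases h2 : c2 = 0
  swap
  · simp only [h11, map_zero, zero_mul, zero_add]
    refine ⟨2, 3, _, HasTop.add_low t2 (HasTop.add_low (t1.low ?_ ?_ ?_) (rest.low ?_ ?_ ?_)),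
      ?_, ?_, ?_, mul_ne_zero h2 (neg_ne_zero.2 (pow_ne_zero 4 hu))⟩ <;> decide
  by_cases h1 : c1 = 0
  swap
  · simp only [h11, h2, map_zero, zero_mul, zero_add]
    refine ⟨1, 2, _, HasTop.add_low t1 (rest.low ?_ ?_ ?_), ?_, ?_, ?_,
      mul_ne_zero h1 (pow_ne_zero 2 hu)⟩ <;> decide
  simp only [h11, h2, h1, map_zero, zero_mul, zero_add]
  exact ⟨0, 1, _, rest, by decide, by decide, by decide, mul_ne_zero h13 one_ne_zero⟩

/-! ### The critical case -/

/-- The coefficients for which the `y3`-leading terms of the images of `t_r` and `t_g` cancel. -/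
structure Critical (A : Matrix (Fin 3) (Fin 3) k) (d : Fin 3 → k) : Prop where
  n31 : A 2 0 ≠ 0
  n32 : A 2 1 ≠ 0
  n33 : A 2 2 ≠ 0
  h33 : A 2 0 * A 2 2 - A 2 1 ^ 2 = 0
  h23 : A 1 0 * A 2 2 + A 2 0 * A 1 2 - 2 * A 1 1 * A 2 1 = 0
  h22 : A 1 0 * A 1 2 - A 1 1 ^ 2 + polar A = 0
  h12 : A 0 0 * A 1 2 + A 1 0 * A 0 2 - 2 * A 0 1 * A 1 1 = 0
  h13 : polar A ≠ 0
  hρ : A 2 1 * linCoeff A d 2 + A 2 0 ^ 2 = 0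

/-- The part of `tfAt` without `y3` in the critical case. -/
def tfAtLow (A : Matrix (Fin 3) (Fin 3) k) (d : Fin 3 → k) (y1 y2 t : MvPolynomial (Fin 6) k) :
    MvPolynomial (Fin 6) k :=
  C (A 0 0 * A 0 2 - A 0 1 ^ 2) * y1 ^ 2 + C (linCoeff A d 1) * y2 +
    (C (linCoeff A d 0) * y1 + C (polar A) * t + C (d 0 * d 2 - d 1 ^ 2))

/-- The scalar by which the `y3^2`-coefficient of the image of `t_g` is proportional to
`polar A * y1 + linCoeff A d 2`. -/
def ratio (A : Matrix (Fin 3) (Fin 3) k) : k := A 2 0 ^ 3 / A 2 1 ^ 2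

namespace Critical

lemma linCoeff_ne_zero (hc : Critical A d) : linCoeff A d 2 ≠ 0 := by
  intro h
  have := hc.hρ
  rw [h] at this
  exact hc.n31 (by simpa using this)

lemma tfAt_eq (hc : Critical A d) :
    tfAt A d y1 y2 y3 t = C (linCoeff A d 2) * y3 + tfAtLow A d y1 y2 t := by
  rw [YasudaPaper.tfAt_eq, hc.h33, hc.h23, hc.h22, hc.h12, tfAtLow]
  simp

lemma hasTop_tfAt (hc : Critical A d) (hf : Frame u y1 y2 y3 t) :
    HasTop 3 4 (linCoeff A d 2 * u ^ 6) (tfAt A d y1 y2 y3 t) := by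
  rw [hc.tfAt_eq, tfAtLow]
  refine (hf.top3.C_mul _).add_low (HasTop.add_low (HasTop.add_low ?_ ?_)
    (HasTop.add_low (HasTop.add_low ?_ ?_) ?_))
  · exact ((hf.top1.pow 2).C_mul _).low (by decide) (by decide) (by decide)
  · exact (hf.top2.C_mul _).low (by decide) (by decide) (by decide)
  · exact (hf.top1.C_mul _).low (by decide) (by decide) (by decide)
  · exact (hf.topt.C_mul _).low (by decide) (by decide) (by decide)
  · exact (HasTop.const _).low (by decide) (by decide) (by decide)

lemma tr_eq (hc : Critical A d) :
    affAt A d y1 y2 y3 1 * tfAt A d y1 y2 y3 t + affAt A d y1 y2 y3 0 ^ 2 =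
      y3 * (C (A 2 1) * tfAtLow A d y1 y2 t + C (linCoeff A d 2) * affAtLow A d y1 y2 1 +
        C (2 * A 2 0) * affAtLow A d y1 y2 0) +
      (affAtLow A d y1 y2 1 * tfAtLow A d y1 y2 t + affAtLow A d y1 y2 0 ^ 2) := by
  have e : (C (A 2 1) * C (linCoeff A d 2) + C (A 2 0) ^ 2 : MvPolynomial (Fin 6) k) = 0 := by
    rw [← C_mul, ← C_pow, ← C_add, hc.hρ, C_0]
  rw [affAt_eq, affAt_eq, hc.tfAt_eq]
  simp only [map_mul, map_ofNat]
  linear_combination y3 ^ 2 * e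

lemma tg_eq (hc : Critical A d) :
    affAt A d y1 y2 y3 2 * tfAt A d y1 y2 y3 t ^ 2 +
      2 * affAt A d y1 y2 y3 0 * affAt A d y1 y2 y3 1 * tfAt A d y1 y2 y3 t +
      affAt A d y1 y2 y3 0 ^ 3 =
      C (ratio A) * (C (polar A) * (y3 ^ 2 * y1) + C (linCoeff A d 2) * y3 ^ 2) +
      y3 * (C (A 2 2) * tfAtLow A d y1 y2 t ^ 2 +
        C (2 * linCoeff A d 2) * (affAtLow A d y1 y2 2 * tfAtLow A d y1 y2 t) +
        C 2 * ((C (A 2 0) * affAtLow A d y1 y2 1 + C (A 2 1) * affAtLow A d y1 y2 0) *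
          tfAtLow A d y1 y2 t) +
        C (2 * linCoeff A d 2) * (affAtLow A d y1 y2 0 * affAtLow A d y1 y2 1) +
        C (3 * A 2 0) * affAtLow A d y1 y2 0 ^ 2) +
      (affAtLow A d y1 y2 2 * tfAtLow A d y1 y2 t ^ 2 +
        C 2 * (affAtLow A d y1 y2 0 * affAtLow A d y1 y2 1 * tfAtLow A d y1 y2 t) +
        affAtLow A d y1 y2 0 ^ 3) := by
  have hb := bracket_eq hc.n31 hc.n32 hc.h33 hc.hρ
  have e0 : A 2 2 * linCoeff A d 2 + A 2 0 * A 2 1 = 0 := by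
    apply mul_left_cancel₀ hc.n31
    linear_combination linCoeff A d 2 * hc.h33 + A 2 1 * hc.hρ
  have e1 : A 2 2 * linCoeff A d 2 ^ 2 + 2 * A 2 0 * A 2 1 * linCoeff A d 2 + A 2 0 ^ 3 = 0 := by
    linear_combination linCoeff A d 2 * e0 + A 2 0 * hc.hρ
  have b2 := hb (A 1 0) (A 1 1) (A 1 2)
  have b1 := hb (A 0 0) (A 0 1) (A 0 2)
  have b0 := hb (d 0) (d 1) (d 2)
  have z2 : A 1 0 * A 2 2 - 2 * (A 1 1 * A 2 1) + A 1 2 * A 2 0 = 0 := by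
    linear_combination hc.h23
  rw [z2, mul_zero] at b2
  change _ = ratio A * polar A at b1
  change _ = ratio A * linCoeff A d 2 at b0
  apply_fun (C : k → MvPolynomial (Fin 6) k) at e0 e1 b2 b1 b0
  simp only [map_add, map_mul, map_pow, map_ofNat, map_zero] at e0 e1 b2 b1 b0
  rw [affAt_eq, affAt_eq, affAt_eq, hc.tfAt_eq]
  generalize tfAtLow A d y1 y2 t = W
  simp only [affAtLow, map_mul, map_ofNat]
  linear_combination y3 ^ 3 * e1 + 2 * y3 ^ 2 * W * e0 + y3 ^ 2 * y2 * b2 + y3 ^ 2 * y1 * b1 +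
    y3 ^ 2 * b0

lemma goodTops_of_quadratic (hc : Critical A d) (hf : Frame u y1 y2 y3 t) (hu : u ≠ 0)
    (h11 : A 0 0 * A 0 2 - A 0 1 ^ 2 ≠ 0) :
    GoodTops (affAt A d y1 y2 y3 1 * tfAt A d y1 y2 y3 t + affAt A d y1 y2 y3 0 ^ 2)
      (tfAt A d y1 y2 y3 t)
      (affAt A d y1 y2 y3 2 * tfAt A d y1 y2 y3 t ^ 2 +
        2 * affAt A d y1 y2 y3 0 * affAt A d y1 y2 y3 1 * tfAt A d y1 y2 y3 t +
        affAt A d y1 y2 y3 0 ^ 3) := by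
  have hF := hc.hasTop_tfAt hf
  rw [hc.tr_eq, hc.tg_eq]
  have Z0 := hf.affAtLow (A := A) (d := d) 0
  have Z1 := hf.affAtLow (A := A) (d := d) 1
  have Z2 := hf.affAtLow (A := A) (d := d) 2
  have hW : HasTop 2 4 ((A 0 0 * A 0 2 - A 0 1 ^ 2) * (u ^ 2) ^ 2) (tfAtLow A d y1 y2 t) := by
    rw [tfAtLow]
    refine HasTop.add_low (HasTop.add_low ((hf.top1.pow 2).C_mul _) ?_)
      (HasTop.add_low (HasTop.add_low ?_ ?_) ?_)
    · exact (hf.top2.C_mul _).low (by decide) (by decide) (by decide)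
    · exact (hf.top1.C_mul _).low (by decide) (by decide) (by decide)
    · exact (hf.topt.C_mul _).low (by decide) (by decide) (by decide)
    · exact (HasTop.const _).low (by decide) (by decide) (by decide)
  have hu2 : (u ^ 2) ^ 2 ≠ 0 := pow_ne_zero 2 (pow_ne_zero 2 hu)
  have hu6 : u ^ 6 ≠ 0 := pow_ne_zero 6 hu
  generalize tfAtLow A d y1 y2 t = W at *
  refine ⟨5, 3, 7, 8, 4, 12, _, _, _,
    HasTop.add_low (hf.top3.mul (HasTop.add_low (HasTop.add_low (hW.C_mul _) ?_) ?_))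
      (HasTop.add_low ?_ ?_), hF,
    HasTop.add_low (HasTop.low_add (HasTop.C_mul_low _ (HasTop.add_low ?_ ?_))
      (hf.top3.mul (HasTop.add_low (HasTop.add_low (HasTop.add_low (HasTop.add_low
        ((hW.pow 2).C_mul _) ?_) ?_) ?_) ?_))) (HasTop.add_low (HasTop.add_low ?_ ?_) ?_),
    mul_ne_zero hu6 (mul_ne_zero hc.n32 (mul_ne_zero h11 hu2)),
    mul_ne_zero hc.linCoeff_ne_zero hu6,
    mul_ne_zero hu6 (mul_ne_zero hc.n33 (pow_ne_zero 2 (mul_ne_zero h11 hu2))),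
    by decide, by decide, by decide, by decide, by decide, by decide⟩
  · exact (Z1.C_mul _).low (by decide) (by decide) (by decide)
  · exact (Z0.C_mul _).low (by decide) (by decide) (by decide)
  · exact (Z1.mul hW).low (by decide) (by decide) (by decide)
  · exact (Z0.pow 2).low (by decide) (by decide) (by decide)
  · exact (((hf.top3.pow 2).mul hf.top1).C_mul _).low (by decide) (by decide) (by decide)
  · exact ((hf.top3.pow 2).C_mul _).low (by decide) (by decide) (by decide)
  · exact ((Z2.mul hW).C_mul _).low (by decide) (by decide) (by decide)
  · exact ((((Z1.C_mul _).add (Z0.C_mul _)).mul hW).C_mul _).low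
      (by decide) (by decide) (by decide)
  · exact ((Z0.mul Z1).C_mul _).low (by decide) (by decide) (by decide)
  · exact ((Z0.pow 2).C_mul _).low (by decide) (by decide) (by decide)
  · exact (Z2.mul (hW.pow 2)).low (by decide) (by decide) (by decide)
  · exact (((Z0.mul Z1).mul hW).C_mul _).low (by decide) (by decide) (by decide)
  · exact (Z0.pow 3).low (by decide) (by decide) (by decide)

lemma hasTop_tfAtLow (hf : Frame u y1 y2 y3 t) (h11 : A 0 0 * A 0 2 - A 0 1 ^ 2 = 0) :
    HasTop 2 3 (-(linCoeff A d 1 * u ^ 4)) (tfAtLow A d y1 y2 t) := by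
  rw [tfAtLow, h11, map_zero, zero_mul, zero_add]
  refine HasTop.add_low ((hf.top2.C_mul _).of_eq (by ring))
    (HasTop.add_low (HasTop.add_low ?_ ?_) ?_)
  · exact (hf.top1.C_mul _).low (by decide) (by decide) (by decide)
  · exact (hf.topt.C_mul _).low (by decide) (by decide) (by decide)
  · exact (HasTop.const _).low (by decide) (by decide) (by decide)

lemma goodTops_of_linear [CharZero k] (hc : Critical A d) (hf : Frame u y1 y2 y3 t) (hu : u ≠ 0)
    (h11 : A 0 0 * A 0 2 - A 0 1 ^ 2 = 0)
    (hε : A 2 1 * linCoeff A d 1 + A 1 1 * linCoeff A d 2 + 2 * A 2 0 * A 1 0 ≠ 0) :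
    GoodTops (affAt A d y1 y2 y3 1 * tfAt A d y1 y2 y3 t + affAt A d y1 y2 y3 0 ^ 2)
      (tfAt A d y1 y2 y3 t)
      (affAt A d y1 y2 y3 2 * tfAt A d y1 y2 y3 t ^ 2 +
        2 * affAt A d y1 y2 y3 0 * affAt A d y1 y2 y3 1 * tfAt A d y1 y2 y3 t +
        affAt A d y1 y2 y3 0 ^ 3) := by
  have hF := hc.hasTop_tfAt hf
  rw [hc.tr_eq, hc.tg_eq]
  have Z0 := hf.affAtLow (A := A) (d := d) 0
  have Z1 := hf.affAtLow (A := A) (d := d) 1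
  have Z2 := hf.affAtLow (A := A) (d := d) 2
  have hW := hasTop_tfAtLow (d := d) hf h11
  have hs := sq_eps_eq hc.n31 hc.n32 hc.h33 hc.h23 hc.h13 hc.h22 hc.h12 h11 hc.hρ
    (c2 := linCoeff A d 1)
  have hu6 : u ^ 6 ≠ 0 := pow_ne_zero 6 hu
  generalize tfAtLow A d y1 y2 t = W at *
  refine ⟨5, 3, 7, 7, 4, 10, -(A 2 1 * linCoeff A d 1 + A 1 1 * linCoeff A d 2 +
      2 * A 2 0 * A 1 0) * u ^ 10, _,
    (A 2 2 * linCoeff A d 1 ^ 2 + 2 * A 1 2 * linCoeff A d 2 * linCoeff A d 1 +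
      2 * ((A 2 0 * A 1 1 + A 2 1 * A 1 0) * linCoeff A d 1 + A 1 0 * A 1 1 * linCoeff A d 2) +
      3 * A 2 0 * A 1 0 ^ 2 + ratio A * polar A) * u ^ 14,
    HasTop.add_low ((hf.top3.mul (((hW.C_mul _).add (Z1.C_mul _)).add (Z0.C_mul _))).of_eq
      (by ring)) (HasTop.add_low ?_ ?_), hF,
    HasTop.add_low (((HasTop.C_mul _ ((((hf.top3.pow 2).mul hf.top1).C_mul _).add_low ?_)).add
      (hf.top3.mul (((((((hW.pow 2).C_mul _).add ((Z2.mul hW).C_mul _)).add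
        ((((Z1.C_mul _).add (Z0.C_mul _)).mul hW).C_mul _))).add ((Z0.mul Z1).C_mul _)).add
        ((Z0.pow 2).C_mul _)))).of_eq (by ring)) (HasTop.add_low (HasTop.add_low ?_ ?_) ?_),
    mul_ne_zero (neg_ne_zero.2 hε) (pow_ne_zero 10 hu),
    mul_ne_zero hc.linCoeff_ne_zero hu6,
    mul_ne_zero ?_ (pow_ne_zero 14 hu),
    by decide, by decide, by decide, by decide, by decide, by decide⟩
  · exact (Z1.mul hW).low (by decide) (by decide) (by decide)
  · exact (Z0.pow 2).low (by decide) (by decide) (by decide)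
  · exact ((hf.top3.pow 2).C_mul _).low (by decide) (by decide) (by decide)
  · exact (Z2.mul (hW.pow 2)).low (by decide) (by decide) (by decide)
  · exact (((Z0.mul Z1).mul hW).C_mul _).low (by decide) (by decide) (by decide)
  · exact (Z0.pow 3).low (by decide) (by decide) (by decide)
  · intro h
    apply pow_ne_zero 2 hε
    rw [← hs]
    simp only [ratio, polar] at h
    rw [h, mul_zero]

end Critical

/-- The part of `affAt` without `y2` and `y3`. -/
def affAtConst (A : Matrix (Fin 3) (Fin 3) k) (d : Fin 3 → k) (y1 : MvPolynomial (Fin 6) k)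
    (j : Fin 3) : MvPolynomial (Fin 6) k :=
  C (A 0 j) * y1 + C (d j)

/-- The part of `tfAt` without `y2` and `y3` in the most degenerate case. -/
def tfAtConst (A : Matrix (Fin 3) (Fin 3) k) (d : Fin 3 → k) (y1 t : MvPolynomial (Fin 6) k) :
    MvPolynomial (Fin 6) k :=
  C (linCoeff A d 0) * y1 + C (polar A) * t + C (d 0 * d 2 - d 1 ^ 2)

lemma affAtLow_eq (j : Fin 3) :
    affAtLow A d y1 y2 j = C (A 1 j) * y2 + affAtConst A d y1 j := by
  rw [affAtLow, affAtConst, add_assoc]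

lemma tfAtLow_eq (h11 : A 0 0 * A 0 2 - A 0 1 ^ 2 = 0) :
    tfAtLow A d y1 y2 t = C (linCoeff A d 1) * y2 + tfAtConst A d y1 t := by
  rw [tfAtLow, tfAtConst, h11, map_zero, zero_mul, zero_add]

lemma Frame.affAtConst (hf : Frame u y1 y2 y3 t) (j : Fin 3) :
    HasTop 1 2 (A 0 j * u ^ 2) (affAtConst A d y1 j) :=
  (hf.top1.C_mul _).add_low ((HasTop.const _).low (by decide) (by decide) (by decide))

lemma Frame.tfAtConst (hf : Frame u y1 y2 y3 t) :
    HasTop 1 2 (linCoeff A d 0 * u ^ 2) (tfAtConst A d y1 t) :=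
  ((hf.top1.C_mul _).add_low ((hf.topt.C_mul _).low (by decide) (by decide) (by decide))).add_low
    ((HasTop.const _).low (by decide) (by decide) (by decide))

/-- The coefficient of `y1*y3` in the image of `t_r` in the most degenerate case. -/
def corrR (A : Matrix (Fin 3) (Fin 3) k) (d : Fin 3 → k) : k :=
  A 2 1 * linCoeff A d 0 + A 0 1 * linCoeff A d 2 + 2 * A 2 0 * A 0 0

/-- The coefficient of `y1*y2*y3` in the image of `t_g` in the most degenerate case. -/
def corrG (A : Matrix (Fin 3) (Fin 3) k) (d : Fin 3 → k) : k :=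
  2 * A 2 2 * linCoeff A d 0 * linCoeff A d 1 +
    2 * linCoeff A d 2 * (A 1 2 * linCoeff A d 0 + A 0 2 * linCoeff A d 1) +
    2 * ((A 2 0 * A 1 1 + A 2 1 * A 1 0) * linCoeff A d 0 +
      (A 2 0 * A 0 1 + A 2 1 * A 0 0) * linCoeff A d 1 +
      (A 0 0 * A 1 1 + A 1 0 * A 0 1) * linCoeff A d 2) + 6 * A 2 0 * A 0 0 * A 1 0

namespace Critical

lemma tr_corr_eq (hc : Critical A d) (h11 : A 0 0 * A 0 2 - A 0 1 ^ 2 = 0)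
    (hε : A 2 1 * linCoeff A d 1 + A 1 1 * linCoeff A d 2 + 2 * A 2 0 * A 1 0 = 0) :
    affAt A d y1 y2 y3 1 * tfAt A d y1 y2 y3 t + affAt A d y1 y2 y3 0 ^ 2 +
      C (corrR A d) * (t - (y1 * y3 - y2 ^ 2)) =
    C (corrR A d + A 1 1 * linCoeff A d 1 + A 1 0 ^ 2) * y2 ^ 2 +
    C (A 2 1 * polar A) * (y3 * t) +
    C (A 1 1 * linCoeff A d 0 + A 0 1 * linCoeff A d 1 + 2 * A 1 0 * A 0 0) * (y1 * y2) +
    C (A 2 1 * (d 0 * d 2 - d 1 ^ 2) + linCoeff A d 2 * d 1 + 2 * A 2 0 * d 0) * y3 +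
    (C (corrR A d) * t + C (A 1 1 * polar A) * (y2 * t) +
      C (A 1 1 * (d 0 * d 2 - d 1 ^ 2) + linCoeff A d 1 * d 1 + 2 * A 1 0 * d 0) * y2 +
      affAtConst A d y1 1 * tfAtConst A d y1 t + affAtConst A d y1 0 ^ 2) := by
  rw [hc.tr_eq, tfAtLow_eq h11, affAtLow_eq, affAtLow_eq]
  apply_fun (C : k → MvPolynomial (Fin 6) k) at hε
  simp only [corrR, affAtConst, tfAtConst, map_add, map_mul, map_sub, map_pow, map_ofNat,
    map_zero] at hε ⊢
  linear_combination y3 * y2 * hε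

lemma tg_corr_eq [CharZero k] (hc : Critical A d) (h11 : A 0 0 * A 0 2 - A 0 1 ^ 2 = 0)
    (hε : A 2 1 * linCoeff A d 1 + A 1 1 * linCoeff A d 2 + 2 * A 2 0 * A 1 0 = 0) :
    affAt A d y1 y2 y3 2 * tfAt A d y1 y2 y3 t ^ 2 +
      2 * affAt A d y1 y2 y3 0 * affAt A d y1 y2 y3 1 * tfAt A d y1 y2 y3 t +
      affAt A d y1 y2 y3 0 ^ 3 +
      (C (ratio A * polar A) * y3 + C (corrG A d) * y2) * (t - (y1 * y3 - y2 ^ 2)) =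
    C (ratio A * linCoeff A d 2) * y3 ^ 2 +
    (C (ratio A * polar A) * (y3 * t) + C (corrG A d) * (y2 * t) +
      C (polar A * (2 * A 2 2 * linCoeff A d 1 + 2 * linCoeff A d 2 * A 1 2 +
        2 * (A 2 0 * A 1 1 + A 2 1 * A 1 0))) * (y3 * y2 * t) +
      C ((2 * A 2 2 * linCoeff A d 1 + 2 * linCoeff A d 2 * A 1 2 +
        2 * (A 2 0 * A 1 1 + A 2 1 * A 1 0)) * (d 0 * d 2 - d 1 ^ 2) +
        2 * linCoeff A d 2 * (linCoeff A d 1 * d 2 + A 1 0 * d 1 + A 1 1 * d 0) +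
        2 * (A 2 0 * d 1 + A 2 1 * d 0) * linCoeff A d 1 + 6 * A 2 0 * A 1 0 * d 0) * (y3 * y2) +
      y3 * (C (A 2 2) * tfAtConst A d y1 t ^ 2 +
        C (2 * linCoeff A d 2) * (affAtConst A d y1 2 * tfAtConst A d y1 t) +
        C 2 * ((C (A 2 0) * affAtConst A d y1 1 + C (A 2 1) * affAtConst A d y1 0) *
          tfAtConst A d y1 t) +
        C (2 * linCoeff A d 2) * (affAtConst A d y1 0 * affAtConst A d y1 1) +
        C (3 * A 2 0) * affAtConst A d y1 0 ^ 2) +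
      y2 ^ 2 * (C (2 * A 1 2 * linCoeff A d 1 + 2 * A 1 0 * A 1 1) * tfAtConst A d y1 t +
        C (linCoeff A d 1 ^ 2) * affAtConst A d y1 2 +
        C (2 * linCoeff A d 1 * A 1 0) * affAtConst A d y1 1 +
        C (2 * linCoeff A d 1 * A 1 1 + 3 * A 1 0 ^ 2) * affAtConst A d y1 0) +
      y2 * (C (A 1 2) * tfAtConst A d y1 t ^ 2 +
        C (2 * linCoeff A d 1) * (affAtConst A d y1 2 * tfAtConst A d y1 t) +
        C 2 * ((C (A 1 0) * affAtConst A d y1 1 + C (A 1 1) * affAtConst A d y1 0) *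
          tfAtConst A d y1 t) +
        C (2 * linCoeff A d 1) * (affAtConst A d y1 0 * affAtConst A d y1 1) +
        C (3 * A 1 0) * affAtConst A d y1 0 ^ 2) +
      (affAtConst A d y1 2 * tfAtConst A d y1 t ^ 2 +
        C 2 * (affAtConst A d y1 0 * affAtConst A d y1 1 * tfAtConst A d y1 t) +
        affAtConst A d y1 0 ^ 3)) := by
  have hs := sq_eps_eq hc.n31 hc.n32 hc.h33 hc.h23 hc.h13 hc.h22 hc.h12 h11 hc.hρ
    (c2 := linCoeff A d 1)
  rw [hε, zero_pow two_ne_zero] at hs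
  replace hs := (mul_eq_zero.1 hs).resolve_left hc.n31
  have h3 := cubic_coeff_eq_zero hc.n31 hc.n32 hc.h33 hc.h23 hc.h13 hc.h22 hc.h12 h11 hc.hρ hε
    (c1 := linCoeff A d 0)
  change _ + ratio A * polar A = 0 at hs
  change corrG A d + _ = 0 at h3
  have hL : C (2 * A 2 2 * linCoeff A d 1 + 2 * linCoeff A d 2 * A 1 2 +
        2 * (A 2 0 * A 1 1 + A 2 1 * A 1 0)) * tfAtConst A d y1 t +
      C (2 * linCoeff A d 2 * linCoeff A d 1) * affAtConst A d y1 2 +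
      C (2 * linCoeff A d 1 * A 2 0 + 2 * linCoeff A d 2 * A 1 0) * affAtConst A d y1 1 +
      C (2 * linCoeff A d 1 * A 2 1 + 2 * linCoeff A d 2 * A 1 1 + 6 * A 2 0 * A 1 0) *
        affAtConst A d y1 0 =
      C (corrG A d) * y1 + C (polar A * (2 * A 2 2 * linCoeff A d 1 + 2 * linCoeff A d 2 * A 1 2 +
        2 * (A 2 0 * A 1 1 + A 2 1 * A 1 0))) * t +
      C ((2 * A 2 2 * linCoeff A d 1 + 2 * linCoeff A d 2 * A 1 2 +
        2 * (A 2 0 * A 1 1 + A 2 1 * A 1 0)) * (d 0 * d 2 - d 1 ^ 2) +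
        2 * linCoeff A d 2 * (linCoeff A d 1 * d 2 + A 1 0 * d 1 + A 1 1 * d 0) +
        2 * (A 2 0 * d 1 + A 2 1 * d 0) * linCoeff A d 1 + 6 * A 2 0 * A 1 0 * d 0) := by
    simp only [corrG, affAtConst, tfAtConst, map_add, map_mul, map_sub, map_pow, map_ofNat]
    ring
  rw [hc.tg_eq, tfAtLow_eq h11, affAtLow_eq, affAtLow_eq, affAtLow_eq]
  generalize affAtConst A d y1 0 = Z0 at *
  generalize affAtConst A d y1 1 = Z1 at *
  generalize affAtConst A d y1 2 = Z2 at *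
  generalize tfAtConst A d y1 t = W at *
  apply_fun (C : k → MvPolynomial (Fin 6) k) at hs h3
  simp only [map_add, map_mul, map_sub, map_pow, map_ofNat, map_zero] at hs h3 hL ⊢
  linear_combination y3 * y2 ^ 2 * hs + y2 ^ 3 * h3 + y3 * y2 * hL

lemma hasTop_tg_corr [CharZero k] (hc : Critical A d) (hf : Frame u y1 y2 y3 t)
    (h11 : A 0 0 * A 0 2 - A 0 1 ^ 2 = 0)
    (hε : A 2 1 * linCoeff A d 1 + A 1 1 * linCoeff A d 2 + 2 * A 2 0 * A 1 0 = 0) :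
    HasTop 6 8 (ratio A * linCoeff A d 2 * u ^ 12)
      (affAt A d y1 y2 y3 2 * tfAt A d y1 y2 y3 t ^ 2 +
        2 * affAt A d y1 y2 y3 0 * affAt A d y1 y2 y3 1 * tfAt A d y1 y2 y3 t +
        affAt A d y1 y2 y3 0 ^ 3 +
        (C (ratio A * polar A) * y3 + C (corrG A d) * y2) * (t - (y1 * y3 - y2 ^ 2))) := by
  rw [hc.tg_corr_eq h11 hε]
  have Z0 := hf.affAtConst (A := A) (d := d) 0
  have Z1 := hf.affAtConst (A := A) (d := d) 1
  have Z2 := hf.affAtConst (A := A) (d := d) 2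
  have W := hf.tfAtConst (A := A) (d := d)
  have quad : ∀ b1 b2 b3 b4 b5 b6 : k, ∃ c, HasTop 2 4 c
      (C b1 * tfAtConst A d y1 t ^ 2 + C b2 * (affAtConst A d y1 2 * tfAtConst A d y1 t) +
        C 2 * ((C b3 * affAtConst A d y1 1 + C b4 * affAtConst A d y1 0) *
          tfAtConst A d y1 t) +
        C b5 * (affAtConst A d y1 0 * affAtConst A d y1 1) + C b6 * affAtConst A d y1 0 ^ 2) :=
    fun b1 b2 b3 b4 b5 b6 => ⟨_, (((((W.pow 2).C_mul b1).add ((Z2.mul W).C_mul b2)).add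
      ((((Z1.C_mul b3).add (Z0.C_mul b4)).mul W).C_mul 2)).add ((Z0.mul Z1).C_mul b5)).add
      ((Z0.pow 2).C_mul b6)⟩
  obtain ⟨_, B⟩ := quad (A 2 2) (2 * linCoeff A d 2) (A 2 0) (A 2 1) (2 * linCoeff A d 2)
    (3 * A 2 0)
  obtain ⟨_, E1⟩ := quad (A 1 2) (2 * linCoeff A d 1) (A 1 0) (A 1 1) (2 * linCoeff A d 1)
    (3 * A 1 0)
  refine HasTop.add_low (((hf.top3.pow 2).C_mul _).of_eq (by ring))
    (HasTop.add_low (HasTop.add_low (HasTop.add_low (HasTop.add_low (HasTop.add_low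
      (HasTop.add_low (HasTop.add_low ?_ ?_) ?_) ?_) ?_) ?_) ?_) ?_)
  · exact ((hf.top3.mul hf.topt).C_mul _).low (by decide) (by decide) (by decide)
  · exact ((hf.top2.mul hf.topt).C_mul _).low (by decide) (by decide) (by decide)
  · exact (((hf.top3.mul hf.top2).mul hf.topt).C_mul _).low (by decide) (by decide) (by decide)
  · exact ((hf.top3.mul hf.top2).C_mul _).low (by decide) (by decide) (by decide)
  · exact (hf.top3.mul B).low (by decide) (by decide) (by decide)
  · exact ((hf.top2.pow 2).mul ((((W.C_mul _).add (Z2.C_mul _)).add (Z1.C_mul _)).add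
      (Z0.C_mul _))).low (by decide) (by decide) (by decide)
  · exact (hf.top2.mul E1).low (by decide) (by decide) (by decide)
  · exact (((Z2.mul (W.pow 2)).add (((Z0.mul Z1).mul W).C_mul 2)).add (Z0.pow 3)).low
      (by decide) (by decide) (by decide)

lemma hasTop_tr_corr [CharZero k] (hc : Critical A d) (hf : Frame u y1 y2 y3 t) (hu : u ≠ 0)
    (h11 : A 0 0 * A 0 2 - A 0 1 ^ 2 = 0)
    (hε : A 2 1 * linCoeff A d 1 + A 1 1 * linCoeff A d 2 + 2 * A 2 0 * A 1 0 = 0) :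
    ∃ m n c, HasTop m n c
      (affAt A d y1 y2 y3 1 * tfAt A d y1 y2 y3 t + affAt A d y1 y2 y3 0 ^ 2 +
        C (corrR A d) * (t - (y1 * y3 - y2 ^ 2))) ∧ m ≤ 4 ∧ n ≤ 6 ∧ 1 ≤ n ∧ c ≠ 0 := by
  rw [hc.tr_corr_eq h11 hε]
  have hℓ := linear_coeff_ne_zero hc.n31 hc.n32 hc.h33 hc.h23 hc.h13 hc.h22 hc.h12 h11
    (d1 := d 0) (d2 := d 1) (d3 := d 2) (c1 := linCoeff A d 0) rfl rfl rfl hc.hρ hε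
  have rest : HasTop 3 4 0 (C (corrR A d) * t + C (A 1 1 * polar A) * (y2 * t) +
      C (A 1 1 * (d 0 * d 2 - d 1 ^ 2) + linCoeff A d 1 * d 1 + 2 * A 1 0 * d 0) * y2 +
      affAtConst A d y1 1 * tfAtConst A d y1 t + affAtConst A d y1 0 ^ 2) := by
    have Z0 := hf.affAtConst (A := A) (d := d) 0
    have Z1 := hf.affAtConst (A := A) (d := d) 1
    have W := hf.tfAtConst (A := A) (d := d)
    refine HasTop.add_low (HasTop.add_low (HasTop.add_low (HasTop.add_low ?_ ?_) ?_) ?_) ?_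
    · exact (hf.topt.C_mul _).low (by decide) (by decide) (by decide)
    · exact ((hf.top2.mul hf.topt).C_mul _).low (by decide) (by decide) (by decide)
    · exact (hf.top2.C_mul _).low (by decide) (by decide) (by decide)
    · exact (Z1.mul W).low (by decide) (by decide) (by decide)
    · exact (Z0.pow 2).low (by decide) (by decide) (by decide)
  have t3 := hf.top3.C_mul
    (A 2 1 * (d 0 * d 2 - d 1 ^ 2) + linCoeff A d 2 * d 1 + 2 * A 2 0 * d 0)
  have t3t := hf.top3.mul hf.topt
  have t12 := hf.top1.mul hf.top2
  have hu4 := neg_ne_zero.2 (pow_ne_zero 4 hu)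
  have hu6 := pow_ne_zero 6 hu
  by_cases hκ : corrR A d + A 1 1 * linCoeff A d 1 + A 1 0 ^ 2 = 0
  swap
  · refine ⟨4, 6, _, HasTop.add_low (HasTop.add_low (HasTop.add_low (HasTop.add_low
      ((hf.top2.pow 2).C_mul _) ((t3t.C_mul _).low ?_ ?_ ?_)) ((t12.C_mul _).low ?_ ?_ ?_))
      (t3.low ?_ ?_ ?_)) (rest.low ?_ ?_ ?_), ?_, ?_, ?_,
      mul_ne_zero hκ (pow_ne_zero 2 hu4)⟩ <;> decide
  rw [hκ, map_zero, zero_mul, zero_add]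
  generalize A 1 1 * linCoeff A d 0 + A 0 1 * linCoeff A d 1 + 2 * A 1 0 * A 0 0 = l
  by_cases hl : A 2 1 * polar A = l
  · refine ⟨3, 4, _, HasTop.add_low (HasTop.low_add ?_ t3) rest, by decide, by decide, by decide,
      mul_ne_zero (hℓ hκ) hu6⟩
    rw [hl, ← mul_add, add_comm]
    exact hf.cancel.C_mul_low l
  · refine ⟨3, 5, _, HasTop.add_low (HasTop.add_low (((t3t.C_mul _).add (t12.C_mul _)).of_eq
      (c' := (A 2 1 * polar A - l) * u ^ 6) (by ring)) (t3.low ?_ ?_ ?_)) (rest.low ?_ ?_ ?_),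
      ?_, ?_, ?_, mul_ne_zero (sub_ne_zero.2 hl) hu6⟩ <;> decide

end Critical

/-- The main estimate: for a suitable correction, the images of the lift have good tops. -/
lemma exists_goodTops [CharZero k] (hf : Frame u y1 y2 y3 t) (hu : u ≠ 0) (hdet : A.det ≠ 0)
    (h31 : A 2 0 ≠ 0) (h32 : A 2 1 ≠ 0) (h33 : A 2 2 ≠ 0) :
    ∃ ν p q : k, GoodTops
      (affAt A d y1 y2 y3 1 * tfAt A d y1 y2 y3 t + affAt A d y1 y2 y3 0 ^ 2 +
        C ν * (t - (y1 * y3 - y2 ^ 2)))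
      (tfAt A d y1 y2 y3 t)
      (affAt A d y1 y2 y3 2 * tfAt A d y1 y2 y3 t ^ 2 +
        2 * affAt A d y1 y2 y3 0 * affAt A d y1 y2 y3 1 * tfAt A d y1 y2 y3 t +
        affAt A d y1 y2 y3 0 ^ 3 +
        (C p * y3 + C q * y2) * (t - (y1 * y3 - y2 ^ 2))) := by
  have hu6 := pow_ne_zero 6 hu
  have X0 := hf.affAt (A := A) (d := d) 0
  have X1 := hf.affAt (A := A) (d := d) 1
  have X2 := hf.affAt (A := A) (d := d) 2
  by_cases hc : Critical A d ∧ A 0 0 * A 0 2 - A 0 1 ^ 2 = 0 ∧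
    A 2 1 * linCoeff A d 1 + A 1 1 * linCoeff A d 2 + 2 * A 2 0 * A 1 0 = 0
  · obtain ⟨hc, h11, hε⟩ := hc
    obtain ⟨m, n, c, hr, hm, hn, hn1, hc0⟩ := hc.hasTop_tr_corr hf hu h11 hε
    exact ⟨corrR A d, ratio A * polar A, corrG A d, m, 3, 6, n, 4, 8, _, _, _, hr,
      hc.hasTop_tfAt hf, hc.hasTop_tg_corr hf h11 hε, hc0, mul_ne_zero hc.linCoeff_ne_zero hu6,
      mul_ne_zero (mul_ne_zero (div_ne_zero (pow_ne_zero 3 h31) (pow_ne_zero 2 h32))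
        hc.linCoeff_ne_zero) (pow_ne_zero 12 hu),
      by omega, by omega, by omega, by omega, by omega, by omega⟩
  refine ⟨0, 0, 0, ?_⟩
  simp only [map_zero, zero_mul, add_zero]
  by_cases hq : A 2 0 * A 2 2 - A 2 1 ^ 2 = 0 ∧
      A 1 0 * A 2 2 + A 2 0 * A 1 2 - 2 * A 1 1 * A 2 1 = 0 ∧
      A 1 0 * A 1 2 - A 1 1 ^ 2 + polar A = 0 ∧
      A 0 0 * A 1 2 + A 1 0 * A 0 2 - 2 * A 0 1 * A 1 1 = 0
  swap
  · obtain ⟨m, n, c, hF, hm, hn, hc0⟩ := tfAt_top_large (d := d) hf hu hq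
    exact goodTops_of_large X0 X1 X2 hF hm hn (mul_ne_zero h32 hu6) (mul_ne_zero h33 hu6) hc0
  obtain ⟨e33, e23, e22, e12⟩ := hq
  have h13 : polar A ≠ 0 := by
    intro h
    apply pow_ne_zero 2 hdet
    rw [det_sq_eq A e33 e23]
    change -(_ * polar A ^ 2) = 0
    simp [h]
  by_cases h3 : linCoeff A d 2 = 0
  · obtain ⟨m, n, c, hF, hm, hn, hn1, hc0⟩ := tfAt_top_small hf hu
      (q11 := A 0 0 * A 0 2 - A 0 1 ^ 2) (c1 := linCoeff A d 0) (c2 := linCoeff A d 1)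
      (c0 := d 0 * d 2 - d 1 ^ 2) h13
    refine goodTops_of_small X0 X1 X2 (c := c) ?_ hm hn hn1 (mul_ne_zero h31 hu6) hc0
    rw [tfAt_eq, e33, e23, e22, e12, h3]
    simpa using hF
  by_cases hρ : A 2 1 * linCoeff A d 2 + A 2 0 ^ 2 = 0
  · have hc' : Critical A d := ⟨h31, h32, h33, e33, e23, e22, e12, h13, hρ⟩
    by_cases h11 : A 0 0 * A 0 2 - A 0 1 ^ 2 = 0
    · exact hc'.goodTops_of_linear hf hu h11 fun hε => hc ⟨hc', h11, hε⟩
    · exact hc'.goodTops_of_quadratic hf hu h11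
  · have hF : HasTop 3 4 (linCoeff A d 2 * u ^ 6) (tfAt A d y1 y2 y3 t) := by
      rw [tfAt_eq, e33, e23, e22, e12]
      simp only [map_zero, zero_mul, zero_add]
      refine (hf.top3.C_mul _).add_low (HasTop.add_low (HasTop.add_low ?_ ?_)
        (hf.tfAtConst.low (by decide) (by decide) (by decide)))
      · exact ((hf.top1.pow 2).C_mul _).low (by decide) (by decide) (by decide)
      · exact (hf.top2.C_mul _).low (by decide) (by decide) (by decide)
    refine goodTops_of_mid X0 X1 X2 hF (by linear_combination u ^ 12 * e33)
      (mul_ne_zero h3 hu6) fun h => hρ ?_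
    apply mul_right_cancel₀ (pow_ne_zero 12 hu)
    linear_combination h

end Core

/-- (Lemma 7 of the paper.)  If the type of
`α ∈ Aff_3(k) \ B` is `(3,3,3)`, then there exists a lift of `α`
which satisfies condition (C). -/
theorem statement19 [CharZero k]
    (hln6 : ∀ p : MvPolynomial (Fin 6) k, ∃ l : ℕ, Del'^[l] p = 0)
    (u : k) (hu : u ≠ 0)
    (φ' : MvPolynomial (Fin 6) k ≃ₐ[k] MvPolynomial (Fin 6) k)
    (hφ' : IsExpOf (fun p => u • Del' p) φ')
    (α : MvPolynomial (Fin 3) k ≃ₐ[k] MvPolynomial (Fin 3) k)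
    (A : Matrix (Fin 3) (Fin 3) k) (d : Fin 3 → k)
    (hdet : IsUnit A.det)
    (hαA : ∀ i : Fin 3, α (X i) = (∑ j : Fin 3, C (A j i) * X j) + C (d i))
    (hαB : α ∉ BSet)
    (γ1 γ2 γ3 : ℕ)
    (ht1 : TypeIs A 0 γ1) (ht2 : TypeIs A 1 γ2) (ht3 : TypeIs A 2 γ3)
    (hcase : γ1 = 3 ∧ γ2 = 3 ∧ γ3 = 3) :
    ∃ α' : MvPolynomial (Fin 6) k →ₐ[k] MvPolynomial (Fin 6) k,
      IsLift α α' ∧ CondC γ1 γ2 γ3 φ' α' := by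
  obtain ⟨rfl, rfl, rfl⟩ := hcase
  have hlast : ∀ j, TypeIs A j 3 → A 2 j ≠ 0 := by
    rintro j ⟨i, hi, hA, -⟩
    have : i = 2 := Fin.ext (by simpa using (Nat.succ.inj hi).symm)
    exact this ▸ hA
  obtain ⟨ν, p, q, m4, m5, m6, n4, n5, n6, c4, c5, c6, hr, hf, hg, hc4, hc5, hc6, hn4, hn5, hm6,
    hm46, hn6, hn46⟩ := exists_goodTops (A := A) (d := d) (exp_frame hφ') hu hdet.ne_zero
      (hlast 0 ht1) (hlast 1 ht2) (hlast 2 ht3)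
  obtain ⟨i0, i1, i2⟩ := ι36_apply
  have hC : ∀ a : k, φ' (C a) = C a := fun a => φ'.commutes a
  have himg : ∀ j, φ' (affImg A d j) = affAt A d (φ' (X 0)) (φ' (X 1)) (φ' (X 2)) j := by
    intro j
    simp [affImg, affAt, Fin.sum_univ_three, i0, i1, i2, hC]
  have htf : φ' (hatTf A d) = tfAt A d (φ' (X 0)) (φ' (X 1)) (φ' (X 2)) (φ' (X 4)) := by
    simp only [hatTf, tfAt, polar, map_add, map_sub, map_mul φ', map_pow φ', himg, hC]
  refine ⟨corrLift A d ν p q, isLift_corrLift α A d hαA ν p q, m4, m5, m6, n4, n5, n6, hn4, hn5,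
    by omega, ?_, ?_, ?_, by omega, by omega, by omega, by omega, by omega, by omega, by omega,
    by omega⟩
  · convert hr.mem_Pset hc4 using 1
    simp [corrLift, himg, htf, hC]
  · convert hf.mem_Pset hc5 using 1
    simp [corrLift, htf]
  · convert hg.mem_Pset hc6 using 1
    simp [corrLift, himg, htf, hC, map_ofNat]

end YasudaPaper
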